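/- arXiv:1309.6604 — 4 statements merged into one kernel-verified Lean document; each statement's English description precedes it below -/
import Mathlib

section
/- Let V be a real Banach space and k ≥ 1. For every h ∈ C_{k+1}(V) satisfying δh = 0 (as an element of C_{k+2}(V)) there exists f ∈ C_k(V) such that δf = h. In other words, the kernel of δ restricted to C_{k+1}(V) coincides with the image of δ : C_k(V) → C_{k+1}(V). -/
open Set

noncomputable section

/-- The unit cube `[0,1]^n`. -/
def cube (n : ℕ) : Set (Fin n → ℝ) := {t | ∀ i, t i ∈ Set.Icc (0 : ℝ) 1}

/-- Membership in `C_n(V)`: continuity on the cube together with vanishing whenever two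
consecutive arguments coincide. -/
def MemC (V : Type*) [NormedAddCommGroup V] [NormedSpace ℝ V] (n : ℕ)
    (g : (Fin n → ℝ) → V) : Prop :=
  ContinuousOn g (cube n) ∧
    ∀ t ∈ cube n, ∀ i j : Fin n, (j : ℕ) = (i : ℕ) + 1 → t i = t j → g t = 0

/-- The coboundary operator `δ : C_n(V) → C_{n+1}(V)`,
`(δ g)_{t_1,…,t_{n+1}} = ∑_{i=1}^{n+1} (-1)^{n-i} g_{t_1,…,\hat t_i,…,t_{n+1}}`. -/
def cob (V : Type*) [NormedAddCommGroup V] [NormedSpace ℝ V] (n : ℕ)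
    (g : (Fin n → ℝ) → V) : (Fin (n + 1) → ℝ) → V :=
  fun t => ∑ j : Fin (n + 1), ((-1 : ℝ) ^ (n + (j : ℕ) + 1)) • g (fun m => t (j.succAbove m))

/-- For `k ≥ 1`, every `h ∈ C_{k+1}(V)` with `δ h = 0` is of the form `h = δ f`
with `f ∈ C_k(V)`. -/
theorem kernel_eq_image_of_coboundary
    (V : Type*) [NormedAddCommGroup V] [NormedSpace ℝ V] [CompleteSpace V]
    (k : ℕ) (hk : 1 ≤ k) (h : (Fin (k + 1) → ℝ) → V)
    (hmem : MemC V (k + 1) h)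
    (hker : ∀ t ∈ cube (k + 2), cob V (k + 1) h t = 0) :
    ∃ f : (Fin k → ℝ) → V, MemC V k f ∧ ∀ t ∈ cube (k + 1), cob V k f t = h t := by
  have hcube : ∀ (n : ℕ) (t : Fin n → ℝ), t ∈ cube n →
      (Fin.cons 0 t : Fin (n + 1) → ℝ) ∈ cube (n + 1) := by
    intro n t ht i
    refine Fin.cases ?_ (fun i => ?_) i
    · simp
    · simpa using ht i
  refine ⟨fun t => ((-1 : ℝ) ^ (k + 1)) • h (Fin.cons 0 t), ⟨?_, ?_⟩, ?_⟩
  · refine ContinuousOn.const_smul ?_ _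
    refine hmem.1.comp (Continuous.continuousOn ?_) (fun t ht => hcube k t ht)
    refine continuous_pi (fun i => ?_)
    refine Fin.cases ?_ (fun i => ?_) i
    · simpa using continuous_const
    · simpa using continuous_apply i
  · intro t ht i j hij hte
    have := hmem.2 (Fin.cons 0 t) (hcube k t ht) i.succ j.succ (by simp [hij]) (by simpa using hte)
    simp [this]
  · intro t ht
    have key := hker (Fin.cons 0 t) (hcube (k + 1) t ht)
    unfold cob at key ⊢
    rw [Fin.sum_univ_succ] at key
    have e0 : (fun m => (Fin.cons 0 t : Fin (k + 2) → ℝ) ((0 : Fin (k + 2)).succAbove m)) = t := by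
      funext m
      simp
    have e1 : ∀ i : Fin (k + 1),
        (fun m => (Fin.cons 0 t : Fin (k + 2) → ℝ) (i.succ.succAbove m))
          = Fin.cons 0 (fun m => t (i.succAbove m)) := by
      intro i
      funext m
      refine Fin.cases ?_ (fun m => ?_) m
      · simp
      · simp
    have e2 : ∀ i : Fin (k + 1), ((-1 : ℝ) ^ (k + 1 + (i.succ : ℕ) + 1))
        = (-1 : ℝ) ^ (k + (i : ℕ) + 1) := by
      intro i
      rw [Fin.val_succ]
      ring
    simp only [e0, e1, e2] at key
    simp only [smul_comm _ ((-1 : ℝ) ^ (k + 1))]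
    rw [← Finset.smul_sum, eq_neg_of_add_eq_zero_right key, smul_neg, smul_smul, ← neg_smul]
    have : -((-1 : ℝ) ^ (k + 1) * (-1) ^ (k + 1 + ((0 : Fin (k + 2)) : ℕ) + 1)) = 1 := by
      have h2 : ((-1 : ℝ) ^ k) * (-1) ^ k = 1 := by
        rw [← mul_pow]; norm_num
      simp only [Fin.val_zero, pow_succ, add_zero]
      linarith
    rw [this, one_smul]
end
end

section
/- (One-dimensional sewing map Λ.) Fix μ > 1 and a real Banach space V. For every h ∈ C_3(V) with δh = 0 and ||h||_μ < ∞ there exists a unique g ∈ C_2^{1+}(V) such that δg = h; moreover this g satisfies ||g||_μ ≤ (2^μ - 2)^{-1} ||h||_μ. -/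
open Set
open scoped ENNReal

noncomputable section

def I01 : Set ℝ := Set.Icc 0 1

/-- Membership in `C_2(V)` (restricted to `[0,1]^2`). -/
def MemC2 (V : Type*) [NormedAddCommGroup V] (g : ℝ → ℝ → V) : Prop :=
  ContinuousOn (fun p : ℝ × ℝ => g p.1 p.2) (I01 ×ˢ I01) ∧ ∀ s ∈ I01, g s s = 0

/-- Membership in `C_3(V)` (restricted to `[0,1]^3`). -/
def MemC3 (V : Type*) [NormedAddCommGroup V] (h : ℝ → ℝ → ℝ → V) : Prop :=
  ContinuousOn (fun p : ℝ × ℝ × ℝ => h p.1 p.2.1 p.2.2) (I01 ×ˢ I01 ×ˢ I01) ∧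
    (∀ s ∈ I01, ∀ t ∈ I01, h s s t = 0) ∧ (∀ s ∈ I01, ∀ t ∈ I01, h s t t = 0)

/-- The coboundary `δ : C_2(V) → C_3(V)`, `(δ g)_{s u t} = g_{s t} - g_{s u} - g_{u t}`. -/
def delta2 (V : Type*) [NormedAddCommGroup V] (g : ℝ → ℝ → V) (s u t : ℝ) : V :=
  g s t - g s u - g u t

/-- The coboundary `δ : C_3(V) → C_4(V)`. -/
def delta3 (V : Type*) [NormedAddCommGroup V] (h : ℝ → ℝ → ℝ → V) (t1 t2 t3 t4 : ℝ) : V :=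
  h t2 t3 t4 - h t1 t3 t4 + h t1 t2 t4 - h t1 t2 t3

/-- The Hölder norm `‖g‖_μ` on `C_2(V)`. -/
noncomputable def norm2H (V : Type*) [NormedAddCommGroup V] (μ : ℝ) (g : ℝ → ℝ → V) : ℝ≥0∞ :=
  ⨆ (s : I01) (t : I01), ENNReal.ofReal (‖g (s : ℝ) (t : ℝ)‖ / |(t : ℝ) - (s : ℝ)| ^ μ)

/-- The Hölder norm `‖h‖_{γ,ρ}` on `C_3(V)`. -/
noncomputable def norm3H (V : Type*) [NormedAddCommGroup V] (γ ρ : ℝ)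
    (h : ℝ → ℝ → ℝ → V) : ℝ≥0∞ :=
  ⨆ (s : I01) (u : I01) (t : I01),
    ENNReal.ofReal (‖h (s : ℝ) (u : ℝ) (t : ℝ)‖ /
      (|(u : ℝ) - (s : ℝ)| ^ γ * |(t : ℝ) - (u : ℝ)| ^ ρ))

/-- The Hölder norm `‖h‖_μ` on `C_3(V)`, defined as an infimum over all finite
decompositions `h = ∑ h_i` with `h_i ∈ C_3(V)`. -/
noncomputable def norm3mu (V : Type*) [NormedAddCommGroup V] (μ : ℝ)
    (h : ℝ → ℝ → ℝ → V) : ℝ≥0∞ :=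
  ⨅ (n : ℕ) (hs : Fin n → (ℝ → ℝ → ℝ → V)) (ρs : Fin n → ℝ)
    (_ : (∀ i, 0 < ρs i ∧ ρs i < μ) ∧ (∀ i, MemC3 V (hs i)) ∧
      (∀ s ∈ I01, ∀ u ∈ I01, ∀ t ∈ I01, h s u t = ∑ i, hs i s u t)),
    ∑ i, norm3H V (ρs i) (μ - ρs i) (hs i)

lemma I01_seg {s t θ : ℝ} (hs : s ∈ I01) (ht : t ∈ I01) (h0 : 0 ≤ θ) (h1 : θ ≤ 1) :
    s + θ * (t - s) ∈ I01 := by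
  obtain ⟨a, b⟩ := hs
  obtain ⟨c, d⟩ := ht
  constructor <;> nlinarith

lemma I01_mid {s t : ℝ} (hs : s ∈ I01) (ht : t ∈ I01) : (s + t) / 2 ∈ I01 := by
  obtain ⟨a, b⟩ := hs
  obtain ⟨c, d⟩ := ht
  constructor <;> linarith

lemma abs_mid1 (s t : ℝ) : |(s + t) / 2 - s| = |t - s| / 2 := by
  rw [show (s + t) / 2 - s = (t - s) / 2 by ring, abs_div, abs_two]

lemma abs_mid2 (s t : ℝ) : |t - (s + t) / 2| = |t - s| / 2 := by
  rw [show t - (s + t) / 2 = (t - s) / 2 by ring, abs_div, abs_two]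

lemma half_rpow (x ν : ℝ) (hx : 0 ≤ x) : (x / 2) ^ ν = (1 / 2 : ℝ) ^ ν * x ^ ν := by
  rw [← Real.mul_rpow (by norm_num) hx]
  congr 1
  ring

lemma half_lt (ν : ℝ) (hν : 1 < ν) : 2 * (1 / 2 : ℝ) ^ ν < 1 := by
  have := Real.rpow_lt_rpow_of_exponent_gt (x := (1 / 2 : ℝ)) (by norm_num) (by norm_num) hν
  rw [Real.rpow_one] at this
  linarith

def MidAdd {V : Type*} [NormedAddCommGroup V] (J : ℝ → ℝ → V) : Prop :=
  ∀ s ∈ I01, ∀ t ∈ I01, J s t = J s ((s + t) / 2) + J ((s + t) / 2) t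

lemma midAdd_zero {V : Type*} [NormedAddCommGroup V] {D : ℝ → ℝ → V} (hD : MidAdd D)
    {C ν : ℝ} (hν : 1 < ν) (hb : ∀ s ∈ I01, ∀ t ∈ I01, ‖D s t‖ ≤ C * |t - s| ^ ν) :
    ∀ s ∈ I01, ∀ t ∈ I01, D s t = 0 := by
  have key : ∀ n : ℕ, ∀ s ∈ I01, ∀ t ∈ I01,
      ‖D s t‖ ≤ (2 * (1 / 2 : ℝ) ^ ν) ^ n * (C * |t - s| ^ ν) := by
    intro n
    induction n with
    | zero => simpa using hb
    | succ n ih =>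
      intro s hs t ht
      have hm := I01_mid hs ht
      have h1 := ih s hs _ hm
      have h2 := ih _ hm t ht
      rw [abs_mid1, half_rpow _ _ (abs_nonneg _)] at h1
      rw [abs_mid2, half_rpow _ _ (abs_nonneg _)] at h2
      rw [hD s hs t ht]
      refine (norm_add_le _ _).trans ((add_le_add h1 h2).trans (le_of_eq ?_))
      ring
  intro s hs t ht
  have hq : 0 ≤ 2 * (1 / 2 : ℝ) ^ ν := by positivity
  have hl := (tendsto_pow_atTop_nhds_zero_of_lt_one hq (half_lt ν hν)).mul_const
    (C * |t - s| ^ ν)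
  rw [zero_mul] at hl
  have := ge_of_tendsto' hl (fun n => key n s hs t ht)
  exact norm_le_zero_iff.mp this

def chainSum {V : Type*} [NormedAddCommGroup V] (J : ℝ → ℝ → V) (a e : ℝ) (k : ℕ) : V :=
  ∑ i ∈ Finset.range k, J (a + i * e) (a + ((i : ℝ) + 1) * e)

lemma chainSum_add {V : Type*} [NormedAddCommGroup V] (J : ℝ → ℝ → V) (a e : ℝ) (j k : ℕ) :
    chainSum J a e (j + k) = chainSum J a e j + chainSum J (a + j * e) e k := by
  unfold chainSum
  rw [Finset.sum_range_add]
  congr 1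
  refine Finset.sum_congr rfl fun i _ => ?_
  push_cast
  congr 1 <;> ring

lemma chainSum_one {V : Type*} [NormedAddCommGroup V] (J : ℝ → ℝ → V) (a e : ℝ) :
    chainSum J a e 1 = J a (a + e) := by
  simp [chainSum]

lemma chainSum_two {V : Type*} [NormedAddCommGroup V] (J : ℝ → ℝ → V) (a e : ℝ) :
    chainSum J a e 2 = J a (a + e) + J (a + e) (a + 2 * e) := by
  simp [chainSum, Finset.sum_range_succ]
  norm_num

lemma chainSum_double {V : Type*} [NormedAddCommGroup V] {J : ℝ → ℝ → V} (hJ : MidAdd J)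
    (a e : ℝ) (k : ℕ) (hk : ∀ i : ℕ, i ≤ k → a + i * e ∈ I01) :
    chainSum J a e k = chainSum J a (e / 2) (2 * k) := by
  induction k with
  | zero => simp [chainSum]
  | succ k ih =>
    rw [chainSum_add, chainSum_one, mul_add, chainSum_add, mul_one, chainSum_two,
      ih (fun i hi => hk i (by omega))]
    have h1 := hk k (by omega)
    have h2 := hk (k + 1) le_rfl
    push_cast at h2
    rw [show a + ((k : ℝ) + 1) * e = a + k * e + e by ring] at h2
    rw [hJ _ h1 _ h2]
    congr 1
    congr 2 <;> push_cast <;> ring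

lemma chainSum_telescope {V : Type*} [NormedAddCommGroup V] {J : ℝ → ℝ → V} {a e : ℝ}
    (h0 : J a a = 0) (K : ℝ) (k : ℕ)
    (hk : ∀ i : ℕ, i < k → ‖J a (a + ((i : ℝ) + 1) * e) - J a (a + i * e)
      - J (a + i * e) (a + ((i : ℝ) + 1) * e)‖ ≤ K) :
    ‖J a (a + k * e) - chainSum J a e k‖ ≤ k * K := by
  induction k with
  | zero => simp [chainSum, h0]
  | succ k ih =>
    have h1 := ih (fun i hi => hk i (by omega))
    have h2 := hk k (by omega)
    rw [chainSum_add, chainSum_one]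
    push_cast
    calc _ = ‖(J a (a + k * e) - chainSum J a e k) + (J a (a + ((k : ℝ) + 1) * e)
          - J a (a + k * e) - J (a + k * e) (a + ((k : ℝ) + 1) * e))‖ := by
            congr 1
            rw [show a + k * e + e = a + ((k : ℝ) + 1) * e by ring]
            abel
      _ ≤ _ := (norm_add_le _ _).trans (by linarith)

lemma I01_step {s t : ℝ} (hs : s ∈ I01) (ht : t ∈ I01) {k i : ℕ} (hk : 0 < k) (hi : i ≤ k) :
    s + i * ((t - s) / k) ∈ I01 := by
  have hk' : (0 : ℝ) < k := by exact_mod_cast hk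
  have hi' : (i : ℝ) ≤ k := by exact_mod_cast hi
  have := I01_seg hs ht (θ := i / k) (by positivity) ((div_le_one hk').2 hi')
  convert this using 1
  ring

lemma midAdd_chain {V : Type*} [NormedAddCommGroup V] {J : ℝ → ℝ → V} (hJ : MidAdd J)
    {C ν : ℝ} (hν : 1 < ν)
    (hb : ∀ d : ℝ, ∀ s ∈ I01, ∀ u ∈ I01, ∀ t ∈ I01, |u - s| ≤ d → |t - u| ≤ d →
      ‖J s t - J s u - J u t‖ ≤ C * d ^ ν)
    (k : ℕ) (hk : 0 < k) : ∀ s ∈ I01, ∀ t ∈ I01, J s t = chainSum J s ((t - s) / k) k := by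
  have hk' : (0 : ℝ) < k := by exact_mod_cast hk
  have hJ0 : ∀ s ∈ I01, J s s = 0 := by
    intro s hs
    have := hJ s hs s hs
    rw [show (s + s) / 2 = s by ring] at this
    simpa using this
  have hD : MidAdd (fun s t => J s t - chainSum J s ((t - s) / k) k) := by
    intro s hs t ht
    have h1 := chainSum_double hJ s ((t - s) / k) k (fun i hi => I01_step hs ht hk hi)
    have h2 : chainSum J s ((t - s) / k / 2) (2 * k) =
        chainSum J s (((s + t) / 2 - s) / k) k +
          chainSum J ((s + t) / 2) ((t - (s + t) / 2) / k) k := by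
      rw [two_mul, chainSum_add]
      congr 2
      · ring
      · field_simp
        ring
      · ring
    simp only
    rw [h1, h2, hJ s hs t ht]
    abel
  have hbd : ∀ s ∈ I01, ∀ t ∈ I01, ‖J s t - chainSum J s ((t - s) / k) k‖ ≤
      (k * C) * |t - s| ^ ν := by
    intro s hs t ht
    have := chainSum_telescope (e := (t - s) / k) (hJ0 s hs) (C * |t - s| ^ ν) k (by
      intro i hi
      have hi' : (i : ℝ) ≤ k := by exact_mod_cast hi.le
      have e1 : s + ((i : ℝ) + 1) * ((t - s) / k) ∈ I01 := by
        exact_mod_cast I01_step hs ht hk (show i + 1 ≤ k by omega)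
      refine hb _ s hs _ (I01_step hs ht hk hi.le) _ e1 ?_ ?_
      · rw [show s + i * ((t - s) / k) - s = (i / k) * (t - s) by ring, abs_mul,
          abs_of_nonneg (by positivity)]
        exact mul_le_of_le_one_left (abs_nonneg _) ((div_le_one hk').2 hi')
      · rw [show s + ((i : ℝ) + 1) * ((t - s) / k) - (s + i * ((t - s) / k))
          = (1 / k) * (t - s) by ring, abs_mul, abs_of_nonneg (by positivity)]
        refine mul_le_of_le_one_left (abs_nonneg _) ((div_le_one hk').2 ?_)
        exact_mod_cast hk)
    rw [show s + k * ((t - s) / k) = t by field_simp; ring] at this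
    rw [mul_assoc]
    exact this
  intro s hs t ht
  exact sub_eq_zero.mp (midAdd_zero hD hν hbd s hs t ht)

lemma midAdd_rat {V : Type*} [NormedAddCommGroup V] {J : ℝ → ℝ → V} (hJ : MidAdd J)
    {C ν : ℝ} (hν : 1 < ν)
    (hb : ∀ d : ℝ, ∀ s ∈ I01, ∀ u ∈ I01, ∀ t ∈ I01, |u - s| ≤ d → |t - u| ≤ d →
      ‖J s t - J s u - J u t‖ ≤ C * d ^ ν)
    (k j : ℕ) (hk : 0 < k) (hj : j ≤ k) : ∀ s ∈ I01, ∀ t ∈ I01,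
    J s t = J s (s + (j / k : ℝ) * (t - s)) + J (s + (j / k : ℝ) * (t - s)) t := by
  intro s hs t ht
  have hk' : (0 : ℝ) < k := by exact_mod_cast hk
  have hJ0 : ∀ s ∈ I01, J s s = 0 := by
    intro s hs
    have := hJ s hs s hs
    rw [show (s + s) / 2 = s by ring] at this
    simpa using this
  rcases Nat.eq_zero_or_pos j with rfl | hj0
  · simp [hJ0 s hs]
  rcases hj.eq_or_lt with rfl | hjk
  · simp [div_self hk'.ne', hJ0 t ht]
  have hj' : (0 : ℝ) < j := by exact_mod_cast hj0
  obtain ⟨l, rfl⟩ := Nat.exists_eq_add_of_le hj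
  have hl : 0 < l := by omega
  have hl' : (0 : ℝ) < l := by exact_mod_cast hl
  have hu : s + (j / (j + l : ℕ) : ℝ) * (t - s) ∈ I01 := by
    have := I01_step hs ht hk hj
    convert this using 1
    ring
  rw [midAdd_chain hJ hν hb _ hk s hs t ht, chainSum_add,
    midAdd_chain hJ hν hb _ hj0 s hs _ hu, midAdd_chain hJ hν hb _ hl _ hu t ht]
  push_cast
  congr 2
  · field_simp
    ring
  · ring
  · field_simp
    ring

lemma midAdd_real {V : Type*} [NormedAddCommGroup V] {J : ℝ → ℝ → V} (hJ : MidAdd J)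
    (hc : ContinuousOn (fun p : ℝ × ℝ => J p.1 p.2) (I01 ×ˢ I01))
    {C ν : ℝ} (hν : 1 < ν)
    (hb : ∀ d : ℝ, ∀ s ∈ I01, ∀ u ∈ I01, ∀ t ∈ I01, |u - s| ≤ d → |t - u| ≤ d →
      ‖J s t - J s u - J u t‖ ≤ C * d ^ ν)
    (θ : ℝ) (h0 : 0 ≤ θ) (h1 : θ ≤ 1) : ∀ s ∈ I01, ∀ t ∈ I01,
    J s t = J s (s + θ * (t - s)) + J (s + θ * (t - s)) t := by
  intro s hs t ht
  have hcont : ContinuousOn (fun x : ℝ => J s (s + x * (t - s)) + J (s + x * (t - s)) t)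
      (Set.Icc 0 1) := by
    apply ContinuousOn.add
    · exact hc.comp (f := fun x : ℝ => (s, s + x * (t - s))) (by fun_prop)
        (fun x hx => ⟨hs, I01_seg hs ht hx.1 hx.2⟩)
    · exact hc.comp (f := fun x : ℝ => (s + x * (t - s), t)) (by fun_prop)
        (fun x hx => ⟨I01_seg hs ht hx.1 hx.2, ht⟩)
  have hfl : ∀ n : ℕ, ⌊θ * n⌋₊ ≤ n := by
    intro n
    apply Nat.floor_le_of_le
    exact mul_le_of_le_one_left (by positivity) h1
  have hseq : Filter.Tendsto (fun n : ℕ => (⌊θ * n⌋₊ : ℝ) / n) Filter.atTop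
      (nhdsWithin θ (Set.Icc 0 1)) := by
    refine tendsto_nhdsWithin_iff.2 ⟨?_, ?_⟩
    · exact (tendsto_nat_floor_mul_div_atTop h0).comp tendsto_natCast_atTop_atTop
    · refine Filter.Eventually.of_forall fun n => ⟨by positivity, ?_⟩
      apply div_le_one_of_le₀ _ (by positivity)
      exact_mod_cast hfl n
  have hlim := (hcont θ ⟨h0, h1⟩).tendsto.comp hseq
  refine tendsto_nhds_unique (tendsto_const_nhds.congr' ?_) hlim
  filter_upwards [Filter.eventually_gt_atTop 0] with n hn
  exact midAdd_rat hJ hν hb n _ hn (hfl n) s hs t ht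

lemma midAdd_full {V : Type*} [NormedAddCommGroup V] {J : ℝ → ℝ → V} (hJ : MidAdd J)
    (hc : ContinuousOn (fun p : ℝ × ℝ => J p.1 p.2) (I01 ×ˢ I01))
    {C ν : ℝ} (hν : 1 < ν)
    (hb : ∀ d : ℝ, ∀ s ∈ I01, ∀ u ∈ I01, ∀ t ∈ I01, |u - s| ≤ d → |t - u| ≤ d →
      ‖J s t - J s u - J u t‖ ≤ C * d ^ ν) :
    ∀ s ∈ I01, ∀ u ∈ I01, ∀ t ∈ I01, J s t = J s u + J u t := by
  have hJ0 : ∀ s ∈ I01, J s s = 0 := by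
    intro s hs
    have := hJ s hs s hs
    rw [show (s + s) / 2 = s by ring] at this
    simpa using this
  have hanti : ∀ s ∈ I01, ∀ t ∈ I01, J s t + J t s = 0 := by
    refine midAdd_zero (D := fun s t => J s t + J t s) (C := C) ?_ hν ?_
    · intro s hs t ht
      simp only
      rw [hJ s hs t ht, hJ t ht s hs, add_comm t s]
      abel
    · intro s hs t ht
      have := hb |t - s| s hs t ht s hs le_rfl (abs_sub_comm s t).le
      rw [hJ0 s hs, ← norm_neg] at this
      rw [show -(0 - J s t - J t s) = J s t + J t s by abel] at this
      exact this
  have hord : ∀ s ∈ I01, ∀ u ∈ I01, ∀ t ∈ I01, s ≤ u → u ≤ t → J s t = J s u + J u t := by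
    intro s hs u hu t ht h1 h2
    rcases (h1.trans h2).eq_or_lt with rfl | hlt
    · obtain rfl : u = s := le_antisymm h2 h1
      simp [hJ0 u hu]
    · have hp : 0 < t - s := by linarith
      have := midAdd_real hJ hc hν hb ((u - s) / (t - s)) (by apply div_nonneg <;> linarith)
        ((div_le_one hp).2 (by linarith)) s hs t ht
      rw [div_mul_cancel₀ _ hp.ne'] at this
      simpa using this
  intro s hs u hu t ht
  have a1 := eq_neg_of_add_eq_zero_left (hanti t ht s hs)
  have a2 := eq_neg_of_add_eq_zero_left (hanti u hu s hs)
  have a3 := eq_neg_of_add_eq_zero_left (hanti t ht u hu)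
  rcases le_total s u with h1 | h1 <;> rcases le_total u t with h2 | h2 <;>
    rcases le_total s t with h3 | h3
  · exact hord s hs u hu t ht h1 h2
  · exact hord s hs u hu t ht h1 h2
  · rw [hord s hs t ht u hu h3 h2, a3]; abel
  · have := hord t ht s hs u hu h3 h1
    rw [a1, a3] at this
    rw [← sub_eq_zero] at this ⊢
    rw [← this]; abel
  · have := hord u hu s hs t ht h1 h3
    rw [this, a2]; abel
  · have := hord u hu t ht s hs h2 h3
    rw [a1, a2] at this
    rw [← sub_eq_zero] at this ⊢
    rw [← this]; abel
  · have := hord t ht u hu s hs h2 h1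
    rw [a1, a3, a2] at this
    rw [← neg_inj, this]; abel
  · have := hord t ht u hu s hs h2 h1
    rw [a1, a3, a2] at this
    rw [← neg_inj, this]; abel

lemma norm3H_bound {V : Type*} [NormedAddCommGroup V] {γ ρ d : ℝ} {h : ℝ → ℝ → ℝ → V}
    (hm : MemC3 V h) (hγ : 0 < γ) (hρ : 0 < ρ) (hd : 0 < d) {s u t : ℝ}
    (hs : s ∈ I01) (hu : u ∈ I01) (ht : t ∈ I01) (h1 : |u - s| ≤ d) (h2 : |t - u| ≤ d) :
    ENNReal.ofReal (‖h s u t‖ / d ^ (γ + ρ)) ≤ norm3H V γ ρ h := by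
  have key : ENNReal.ofReal (‖h s u t‖ / (|u - s| ^ γ * |t - u| ^ ρ)) ≤ norm3H V γ ρ h :=
    le_iSup_of_le (⟨s, hs⟩ : I01) (le_iSup_of_le (⟨u, hu⟩ : I01)
      (le_iSup_of_le (⟨t, ht⟩ : I01) le_rfl))
  by_cases e1 : s = u
  · subst e1
    simp [hm.2.1 s hs t ht]
  by_cases e2 : u = t
  · subst e2
    simp [hm.2.2 s hs u hu]
  have p1 : 0 < |u - s| := abs_pos.2 (sub_ne_zero.2 (Ne.symm e1))
  have p2 : 0 < |t - u| := abs_pos.2 (sub_ne_zero.2 (Ne.symm e2))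
  refine le_trans (ENNReal.ofReal_le_ofReal ?_) key
  rw [Real.rpow_add hd]
  gcongr

lemma norm3mu_bound {V : Type*} [NormedAddCommGroup V] {μ d : ℝ} {h : ℝ → ℝ → ℝ → V}
    (hfin : norm3mu V μ h ≠ ⊤) (hd : 0 < d) {s u t : ℝ}
    (hs : s ∈ I01) (hu : u ∈ I01) (ht : t ∈ I01) (h1 : |u - s| ≤ d) (h2 : |t - u| ≤ d) :
    ‖h s u t‖ ≤ (norm3mu V μ h).toReal * d ^ μ := by
  have hdm : 0 < d ^ μ := Real.rpow_pos_of_pos hd _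
  have key : ENNReal.ofReal (‖h s u t‖ / d ^ μ) ≤ norm3mu V μ h := by
    refine le_iInf fun n => le_iInf fun hs' => le_iInf fun ρs => le_iInf fun H => ?_
    obtain ⟨H1, H2, H3⟩ := H
    calc ENNReal.ofReal (‖h s u t‖ / d ^ μ)
        ≤ ENNReal.ofReal (∑ i, ‖hs' i s u t‖ / d ^ μ) := by
          apply ENNReal.ofReal_le_ofReal
          rw [← Finset.sum_div, H3 s hs u hu t ht]
          gcongr
          exact norm_sum_le _ _
      _ = ∑ i, ENNReal.ofReal (‖hs' i s u t‖ / d ^ μ) :=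
          ENNReal.ofReal_sum_of_nonneg fun i _ => by positivity
      _ ≤ _ := by
          refine Finset.sum_le_sum fun i _ => ?_
          have := norm3H_bound (H2 i) (H1 i).1 (sub_pos.2 (H1 i).2) hd hs hu ht h1 h2
          rwa [add_sub_cancel] at this
  rw [← div_le_iff₀ hdm]
  exact (ENNReal.ofReal_le_iff_le_toReal hfin).1 key

lemma norm2H_bound {V : Type*} [NormedAddCommGroup V] {ν : ℝ} {g : ℝ → ℝ → V}
    (hm : MemC2 V g) (hfin : norm2H V ν g ≠ ⊤) {s t : ℝ}
    (hs : s ∈ I01) (ht : t ∈ I01) : ‖g s t‖ ≤ (norm2H V ν g).toReal * |t - s| ^ ν := by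
  have key : ENNReal.ofReal (‖g s t‖ / |t - s| ^ ν) ≤ norm2H V ν g :=
    le_iSup_of_le (⟨s, hs⟩ : I01) (le_iSup_of_le (⟨t, ht⟩ : I01) le_rfl)
  by_cases e : s = t
  · subst e
    rw [hm.2 s hs, norm_zero]
    positivity
  have p : 0 < |t - s| := abs_pos.2 (sub_ne_zero.2 (Ne.symm e))
  rw [← div_le_iff₀ (Real.rpow_pos_of_pos p _)]
  exact (ENNReal.ofReal_le_iff_le_toReal hfin).1 key

/-- The dyadic corrections. -/
def sewD {V : Type*} [NormedAddCommGroup V] (h : ℝ → ℝ → ℝ → V) : ℕ → ℝ → ℝ → V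
  | 0, s, t => h s ((s + t) / 2) t
  | n + 1, s, t => sewD h n s ((s + t) / 2) + sewD h n ((s + t) / 2) t

lemma sewD_cont {V : Type*} [NormedAddCommGroup V] {h : ℝ → ℝ → ℝ → V} (hm : MemC3 V h)
    (n : ℕ) : ContinuousOn (fun p : ℝ × ℝ => sewD h n p.1 p.2) (I01 ×ˢ I01) := by
  induction n with
  | zero =>
    exact hm.1.comp (f := fun p : ℝ × ℝ => (p.1, (p.1 + p.2) / 2, p.2)) (by fun_prop)
      (fun p hp => ⟨hp.1, I01_mid hp.1 hp.2, hp.2⟩)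
  | succ n ih =>
    apply ContinuousOn.add
    · exact ih.comp (f := fun p : ℝ × ℝ => (p.1, (p.1 + p.2) / 2)) (by fun_prop)
        (fun p hp => ⟨hp.1, I01_mid hp.1 hp.2⟩)
    · exact ih.comp (f := fun p : ℝ × ℝ => ((p.1 + p.2) / 2, p.2)) (by fun_prop)
        (fun p hp => ⟨I01_mid hp.1 hp.2, hp.2⟩)

lemma sewD_bound {V : Type*} [NormedAddCommGroup V] {h : ℝ → ℝ → ℝ → V} {N μ : ℝ}
    (hb : ∀ d : ℝ, ∀ s ∈ I01, ∀ u ∈ I01, ∀ t ∈ I01, |u - s| ≤ d → |t - u| ≤ d →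
      ‖h s u t‖ ≤ N * d ^ μ) (n : ℕ) : ∀ s ∈ I01, ∀ t ∈ I01,
    ‖sewD h n s t‖ ≤ (N * (1 / 2 : ℝ) ^ μ * |t - s| ^ μ) * (2 * (1 / 2 : ℝ) ^ μ) ^ n := by
  induction n with
  | zero =>
    intro s hs t ht
    have := hb (|t - s| / 2) s hs _ (I01_mid hs ht) t ht (abs_mid1 s t).le (abs_mid2 s t).le
    rw [half_rpow _ _ (abs_nonneg _)] at this
    simpa [sewD, mul_assoc] using this
  | succ n ih =>
    intro s hs t ht
    have hm := I01_mid hs ht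
    have h1 := ih s hs _ hm
    have h2 := ih _ hm t ht
    rw [abs_mid1, half_rpow _ _ (abs_nonneg _)] at h1
    rw [abs_mid2, half_rpow _ _ (abs_nonneg _)] at h2
    refine (norm_add_le _ _).trans ((add_le_add h1 h2).trans (le_of_eq ?_))
    ring

lemma abs_sub_le_one {s t : ℝ} (hs : s ∈ I01) (ht : t ∈ I01) : |t - s| ≤ 1 := by
  obtain ⟨a, b⟩ := hs
  obtain ⟨c, d⟩ := ht
  rw [abs_le]
  constructor <;> linarith

/-- The one-dimensional sewing map `Λ`. -/
theorem one_dimensional_sewing_map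
    (V : Type*) [NormedAddCommGroup V] [NormedSpace ℝ V] [CompleteSpace V]
    (μ : ℝ) (hμ : 1 < μ) (h : ℝ → ℝ → ℝ → V) (hmem : MemC3 V h)
    (hker : ∀ t1 ∈ I01, ∀ t2 ∈ I01, ∀ t3 ∈ I01, ∀ t4 ∈ I01, delta3 V h t1 t2 t3 t4 = 0)
    (hfin : norm3mu V μ h ≠ ⊤) :
    ∃ g : ℝ → ℝ → V,
      (MemC2 V g ∧ (∃ ν : ℝ, 1 < ν ∧ norm2H V ν g ≠ ⊤) ∧
        (∀ s ∈ I01, ∀ u ∈ I01, ∀ t ∈ I01, delta2 V g s u t = h s u t)) ∧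
      norm2H V μ g ≤ ENNReal.ofReal (((2:ℝ) ^ μ - 2)⁻¹) * norm3mu V μ h ∧
      ∀ g' : ℝ → ℝ → V,
        (MemC2 V g' ∧ (∃ ν : ℝ, 1 < ν ∧ norm2H V ν g' ≠ ⊤) ∧
          (∀ s ∈ I01, ∀ u ∈ I01, ∀ t ∈ I01, delta2 V g' s u t = h s u t)) →
        ∀ s ∈ I01, ∀ t ∈ I01, g' s t = g s t := by
  obtain ⟨N, hNdef⟩ : ∃ N, N = (norm3mu V μ h).toReal := ⟨_, rfl⟩
  have hN : 0 ≤ N := hNdef ▸ ENNReal.toReal_nonneg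
  have hμ0 : 0 < μ := by linarith
  have hb : ∀ d : ℝ, ∀ s ∈ I01, ∀ u ∈ I01, ∀ t ∈ I01, |u - s| ≤ d → |t - u| ≤ d →
      ‖h s u t‖ ≤ N * d ^ μ := by
    intro d s hs u hu t ht h1 h2
    rcases ((abs_nonneg _).trans h1).eq_or_lt with rfl | hd
    · have e : u = s := by
        have := abs_nonpos_iff.1 h1
        linarith
      subst e
      rw [hmem.2.1 u hu t ht, norm_zero]
      positivity
    · rw [hNdef]
      exact norm3mu_bound hfin hd hs hu ht h1 h2
  obtain ⟨q, hq⟩ : ∃ q, q = (1 / 2 : ℝ) ^ μ := ⟨_, rfl⟩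
  have hq0 : 0 < q := by rw [hq]; positivity
  have hq1 : 2 * q < 1 := hq ▸ half_lt μ hμ
  have hqc : ((2 : ℝ) ^ μ - 2)⁻¹ = q * (1 - 2 * q)⁻¹ := by
    have e : (2 : ℝ) ^ μ = q⁻¹ := by
      rw [hq, one_div, Real.inv_rpow (by norm_num), inv_inv]
    have h1 : 1 - 2 * q ≠ 0 := by linarith
    rw [e, show q⁻¹ - 2 = (1 - 2 * q) / q by field_simp, inv_div]
    rfl
  obtain ⟨c, hc⟩ : ∃ c, c = ((2 : ℝ) ^ μ - 2)⁻¹ := ⟨_, rfl⟩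
  have hc0 : 0 ≤ c := by
    rw [hc, hqc]
    have : 0 < 1 - 2 * q := by linarith
    positivity
  have hD := sewD_bound hb
  rw [← hq] at hD
  have hgeo : Summable (fun n : ℕ => (2 * q) ^ n) :=
    summable_geometric_of_lt_one (by positivity) hq1
  have hsum : ∀ s ∈ I01, ∀ t ∈ I01, Summable (fun n => sewD h n s t) := fun s hs t ht =>
    Summable.of_norm_bounded (hgeo.mul_left _) (fun n => hD n s hs t ht)
  obtain ⟨g, hg⟩ : ∃ g : ℝ → ℝ → V, g = fun s t => ∑' n, sewD h n s t := ⟨_, rfl⟩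
  have hgb : ∀ s ∈ I01, ∀ t ∈ I01, ‖g s t‖ ≤ c * N * |t - s| ^ μ := by
    intro s hs t ht
    rw [hg]
    refine (tsum_of_norm_bounded ((hasSum_geometric_of_lt_one (by positivity) hq1).mul_left _)
      (fun n => hD n s hs t ht)).trans (le_of_eq ?_)
    rw [hc, hqc]
    ring
  have hgc : ContinuousOn (fun p : ℝ × ℝ => g p.1 p.2) (I01 ×ˢ I01) := by
    rw [hg]
    refine continuousOn_tsum (sewD_cont hmem) (hgeo.mul_left (N * q)) ?_
    intro n p hp
    refine (hD n p.1 hp.1 p.2 hp.2).trans ?_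
    refine mul_le_mul_of_nonneg_right ?_ (by positivity)
    apply mul_le_of_le_one_right (by positivity)
    exact Real.rpow_le_one (abs_nonneg _) (abs_sub_le_one hp.1 hp.2) hμ0.le
  have hgmid : ∀ s ∈ I01, ∀ t ∈ I01,
      g s t = h s ((s + t) / 2) t + (g s ((s + t) / 2) + g ((s + t) / 2) t) := by
    intro s hs t ht
    have hm := I01_mid hs ht
    simp only [hg]
    rw [(hsum s hs t ht).tsum_eq_zero_add, ← (hsum s hs _ hm).tsum_add (hsum _ hm t ht)]
    rfl
  have hg0 : ∀ s ∈ I01, g s s = 0 := by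
    intro s hs
    have := hgb s hs s hs
    rw [sub_self, abs_zero, Real.zero_rpow hμ0.ne', mul_zero] at this
    exact norm_le_zero_iff.1 this
  have h0I : (0 : ℝ) ∈ I01 := ⟨le_rfl, zero_le_one⟩
  have hdB : ∀ s ∈ I01, ∀ u ∈ I01, ∀ t ∈ I01,
      h s u t = - h 0 s t + h 0 s u + h 0 u t := by
    intro s hs u hu t ht
    have := hker 0 h0I s hs u hu t ht
    unfold delta3 at this
    rw [← sub_eq_zero, ← this]
    abel
  have hδ : ∀ s ∈ I01, ∀ u ∈ I01, ∀ t ∈ I01, delta2 V g s u t = h s u t := by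
    have hfull := midAdd_full (J := fun s t => - h 0 s t - g s t) (C := N + c * N * 2 ^ μ + c * N
      + c * N) (ν := μ) ?_ ?_ hμ ?_
    · intro s hs u hu t ht
      have := hfull s hs u hu t ht
      rw [hdB s hs u hu t ht]
      unfold delta2
      rw [← sub_eq_zero] at this ⊢
      rw [← neg_eq_zero, ← this]
      abel
    · intro s hs t ht
      simp only
      rw [hgmid s hs t ht, hdB s hs _ (I01_mid hs ht) t ht]
      abel
    · refine ContinuousOn.sub (ContinuousOn.neg ?_) hgc
      exact hmem.1.comp (f := fun p : ℝ × ℝ => (0, p.1, p.2)) (by fun_prop)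
        (fun p hp => ⟨h0I, hp.1, hp.2⟩)
    · intro d s hs u hu t ht h1 h2
      have hd : 0 ≤ d := (abs_nonneg _).trans h1
      have b0 := hb d s hs u hu t ht h1 h2
      have b1 : ‖g s u‖ ≤ c * N * d ^ μ := (hgb s hs u hu).trans (by gcongr)
      have b2 : ‖g u t‖ ≤ c * N * d ^ μ := (hgb u hu t ht).trans (by gcongr)
      have b3 : ‖g s t‖ ≤ c * N * (2 ^ μ * d ^ μ) := by
        refine (hgb s hs t ht).trans ?_
        rw [← Real.mul_rpow (by norm_num) hd]
        gcongr
        have := abs_sub_le t u s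
        linarith
      calc _ = ‖h s u t - g s t + g s u + g u t‖ := by
            congr 1
            rw [hdB s hs u hu t ht]
            abel
        _ ≤ ‖h s u t‖ + ‖g s t‖ + ‖g s u‖ + ‖g u t‖ :=
            (norm_add_le _ _).trans (add_le_add ((norm_add_le _ _).trans
              (add_le_add (norm_sub_le _ _) le_rfl)) le_rfl)
        _ ≤ _ := by linarith
  have hnorm : norm2H V μ g ≤ ENNReal.ofReal (((2:ℝ) ^ μ - 2)⁻¹) * norm3mu V μ h := by
    rw [← hc, ← ENNReal.ofReal_toReal hfin, ← hNdef, ← ENNReal.ofReal_mul hc0]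
    refine iSup_le fun s => iSup_le fun t => ENNReal.ofReal_le_ofReal ?_
    exact div_le_of_le_mul₀ (by positivity) (by positivity) (hgb s s.2 t t.2)
  have hnfin : norm2H V μ g ≠ ⊤ :=
    ne_top_of_le_ne_top (ENNReal.mul_ne_top ENNReal.ofReal_ne_top hfin) hnorm
  refine ⟨g, ⟨⟨hgc, hg0⟩, ⟨μ, hμ, hnfin⟩, hδ⟩, hnorm, ?_⟩
  rintro g' ⟨hm', ⟨ν, hν, hfin'⟩, hδ'⟩ s hs t ht
  refine sub_eq_zero.1 (midAdd_zero (D := fun s t => g' s t - g s t)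
    (C := (norm2H V ν g').toReal + c * N) (ν := min ν μ) ?_ (lt_min hν hμ) ?_ s hs t ht)
  · intro s hs t ht
    have hm := I01_mid hs ht
    have e1 := hδ s hs _ hm t ht
    rw [← hδ' s hs _ hm t ht] at e1
    unfold delta2 at e1
    simp only
    rw [← sub_eq_zero] at e1 ⊢
    rw [← neg_eq_zero, ← e1]
    abel
  · intro s hs t ht
    have hp : 0 < min ν μ := by
      have := lt_min hν hμ
      linarith
    rcases eq_or_ne s t with rfl | hne
    · simp [hm'.2 s hs, hg0 s hs, Real.zero_rpow hp.ne']
    have p : 0 < |t - s| := abs_pos.2 (sub_ne_zero.2 (Ne.symm hne))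
    have l1 : |t - s| ^ ν ≤ |t - s| ^ min ν μ :=
      Real.rpow_le_rpow_of_exponent_ge p (abs_sub_le_one hs ht) (min_le_left _ _)
    have l2 : |t - s| ^ μ ≤ |t - s| ^ min ν μ :=
      Real.rpow_le_rpow_of_exponent_ge p (abs_sub_le_one hs ht) (min_le_right _ _)
    rw [add_mul]
    refine (norm_sub_le _ _).trans (add_le_add ?_ ?_)
    · refine (norm2H_bound hm' hfin' hs ht).trans ?_
      gcongr
    · refine (hgb s hs t ht).trans ?_
      gcongr
end
end

section
/- (Planar sewing maps.) Let γ_1, γ_2 > 1. (1) Suppose h ∈ P_{3,3} satisfies h = δ_1 g_0 for some g_0 ∈ P_{2,3}, and that for some κ_1,ρ_1 > 0 with κ_1 + ρ_1 = γ_1 one has M := sup |h_{s_1 s_2 s_3;t_1 t_2 t_3}|/(|s_2-s_1|^{κ_1}|s_3-s_2|^{ρ_1}|t_2-t_1|^{κ_2}|t_3-t_2|^{ρ_2}) < ∞ for some κ_2,ρ_2 > 0 with κ_2 + ρ_2 = γ_2. Then there exists g ∈ P_{2,3} with δ_1 g = h and sup |g_{s_1 s_2;t_1 t_2 t_3}|/(|s_2-s_1|^{γ_1}|t_2-t_1|^{κ_2}|t_3-t_2|^{ρ_2})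 ≤ c_{γ_1} M for a constant c_{γ_1} depending only on γ_1; the analogous statement holds with the roles of the s- and t-variables exchanged (δ_2 in place of δ_1). (2) Suppose h ∈ P_{3,3}^{γ_1,γ_2} satisfies h = δ g_0 for some g_0 ∈ P_{2,2}, with M as above for some admissible exponents κ_i + ρ_i = γ_i. Then there exists g ∈ P_{2,2}^{γ_1,γ_2} with δ g = h and ||g||_{γ_1;γ_2} ≤ c_{γ_1,γ_2} M for a constant c_{γ_1,γ_2} depending only on γ_1, γ_2. -/
open Set

noncomputable section

/-- Membership in `P_{2,2}`. -/
def MemP22 (g : ℝ → ℝ → ℝ → ℝ → ℝ) : Prop :=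
  ContinuousOn (fun q : ℝ × ℝ × ℝ × ℝ => g q.1 q.2.1 q.2.2.1 q.2.2.2)
    (I01 ×ˢ I01 ×ˢ I01 ×ˢ I01) ∧
  ∀ (s1 s2 t1 t2 : I01), ((s1 : ℝ) = s2 ∨ (t1 : ℝ) = t2) →
    g (s1 : ℝ) (s2 : ℝ) (t1 : ℝ) (t2 : ℝ) = 0

/-- Membership in `P_{2,3}`. -/
def MemP23 (g : ℝ → ℝ → ℝ → ℝ → ℝ → ℝ) : Prop :=
  ContinuousOn (fun q : ℝ × ℝ × ℝ × ℝ × ℝ => g q.1 q.2.1 q.2.2.1 q.2.2.2.1 q.2.2.2.2)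
    (I01 ×ˢ I01 ×ˢ I01 ×ˢ I01 ×ˢ I01) ∧
  ∀ (s1 s2 t1 t2 t3 : I01),
    ((s1 : ℝ) = s2 ∨ (t1 : ℝ) = t2 ∨ (t2 : ℝ) = t3) →
    g (s1 : ℝ) (s2 : ℝ) (t1 : ℝ) (t2 : ℝ) (t3 : ℝ) = 0

/-- Membership in `P_{3,2}`. -/
def MemP32 (g : ℝ → ℝ → ℝ → ℝ → ℝ → ℝ) : Prop :=
  ContinuousOn (fun q : ℝ × ℝ × ℝ × ℝ × ℝ => g q.1 q.2.1 q.2.2.1 q.2.2.2.1 q.2.2.2.2)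
    (I01 ×ˢ I01 ×ˢ I01 ×ˢ I01 ×ˢ I01) ∧
  ∀ (s1 s2 s3 t1 t2 : I01),
    ((s1 : ℝ) = s2 ∨ (s2 : ℝ) = s3 ∨ (t1 : ℝ) = t2) →
    g (s1 : ℝ) (s2 : ℝ) (s3 : ℝ) (t1 : ℝ) (t2 : ℝ) = 0

/-- Membership in `P_{3,3}`. -/
def MemP33 (h : ℝ → ℝ → ℝ → ℝ → ℝ → ℝ → ℝ) : Prop :=
  ContinuousOn
    (fun q : ℝ × ℝ × ℝ × ℝ × ℝ × ℝ =>
      h q.1 q.2.1 q.2.2.1 q.2.2.2.1 q.2.2.2.2.1 q.2.2.2.2.2)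
    (I01 ×ˢ I01 ×ˢ I01 ×ˢ I01 ×ˢ I01 ×ˢ I01) ∧
  ∀ (s1 s2 s3 t1 t2 t3 : I01),
    ((s1 : ℝ) = s2 ∨ (s2 : ℝ) = s3 ∨ (t1 : ℝ) = t2 ∨ (t2 : ℝ) = t3) →
    h (s1 : ℝ) (s2 : ℝ) (s3 : ℝ) (t1 : ℝ) (t2 : ℝ) (t3 : ℝ) = 0

/-- The operator `δ₁ : P_{2,3} → P_{3,3}`. -/
def del1of23 (g : ℝ → ℝ → ℝ → ℝ → ℝ → ℝ) (s1 s2 s3 t1 t2 t3 : ℝ) : ℝ :=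
  g s1 s3 t1 t2 t3 - g s1 s2 t1 t2 t3 - g s2 s3 t1 t2 t3

/-- The operator `δ₂ : P_{3,2} → P_{3,3}`. -/
def del2of32 (g : ℝ → ℝ → ℝ → ℝ → ℝ → ℝ) (s1 s2 s3 t1 t2 t3 : ℝ) : ℝ :=
  g s1 s2 s3 t1 t3 - g s1 s2 s3 t1 t2 - g s1 s2 s3 t2 t3

/-- The operator `δ₂ : P_{2,2} → P_{2,3}`. -/
def del2of22 (g : ℝ → ℝ → ℝ → ℝ → ℝ) (s1 s2 t1 t2 t3 : ℝ) : ℝ :=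
  g s1 s2 t1 t3 - g s1 s2 t1 t2 - g s1 s2 t2 t3

/-- The operator `δ = δ₁ δ₂ : P_{2,2} → P_{3,3}`. -/
def delFull (g : ℝ → ℝ → ℝ → ℝ → ℝ) (s1 s2 s3 t1 t2 t3 : ℝ) : ℝ :=
  del2of22 g s1 s3 t1 t2 t3 - del2of22 g s1 s2 t1 t2 t3 - del2of22 g s2 s3 t1 t2 t3

open Filter Topology

def cl (a b t : ℝ) : ℝ := max a (min t b)

lemma cl_left {a b t : ℝ} (hab : a ≤ b) (h : t ≤ a) : cl a b t = a := by
  unfold cl; rw [max_eq_left]; exact (min_le_left _ _).trans h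

lemma cl_right {a b t : ℝ} (hab : a ≤ b) (h : b ≤ t) : cl a b t = b := by
  unfold cl; rw [min_eq_right h, max_eq_right hab]

lemma cl_mid {a b t : ℝ} (h : a ≤ t) (h' : t ≤ b) : cl a b t = t := by
  unfold cl; rw [min_eq_left h', max_eq_right h]

lemma le_cl (a b t : ℝ) : a ≤ cl a b t := le_max_left _ _

lemma cl_le {a b : ℝ} (t : ℝ) (hab : a ≤ b) : cl a b t ≤ b :=
  max_le hab (min_le_right _ _)

lemma cl_abs (a b s t : ℝ) : |cl a b s - cl a b t| ≤ |s - t| := by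
  unfold cl
  refine (abs_max_sub_max_le_max _ _ _ _).trans ?_
  rw [sub_self, abs_zero, max_eq_right (abs_nonneg _)]
  refine (abs_min_sub_min_le_max _ _ _ _).trans ?_
  simp

lemma cl_cont (a b : ℝ) : Continuous (cl a b) := by unfold cl; fun_prop

def Phi (f : ℝ → ℝ → ℝ) (n : ℕ) (t : ℝ) : ℝ :=
  ∑ k ∈ Finset.range (2 ^ n),
    f ((k : ℝ) / 2 ^ n) (cl ((k : ℝ) / 2 ^ n) (((k : ℝ) + 1) / 2 ^ n) t)

lemma sum_range_two_mul' (F : ℕ → ℝ) (N : ℕ) :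
    ∑ k ∈ Finset.range (2 * N), F k
      = ∑ k ∈ Finset.range N, (F (2 * k) + F (2 * k + 1)) := by
  induction N with
  | zero => simp
  | succ N ih =>
    rw [Finset.sum_range_succ, ← ih, mul_add, mul_one, Finset.sum_range_succ,
      Finset.sum_range_succ]
    ring

/-- the increment of level n at cell k -/
def ee (f : ℝ → ℝ → ℝ) (n k : ℕ) (t : ℝ) : ℝ :=
  f ((k : ℝ) / 2 ^ n) (cl ((2 * (k : ℝ) + 1) / 2 ^ (n + 1)) (((k : ℝ) + 1) / 2 ^ n) t)
  - f ((k : ℝ) / 2 ^ n) ((2 * (k : ℝ) + 1) / 2 ^ (n + 1))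
  - f ((2 * (k : ℝ) + 1) / 2 ^ (n + 1))
    (cl ((2 * (k : ℝ) + 1) / 2 ^ (n + 1)) (((k : ℝ) + 1) / 2 ^ n) t)

lemma mid1 (n k : ℕ) : (k : ℝ) / 2 ^ n ≤ (2 * (k : ℝ) + 1) / 2 ^ (n + 1) := by
  rw [div_le_div_iff₀ (by positivity) (by positivity), pow_succ]
  have : (0 : ℝ) < 2 ^ n := by positivity
  nlinarith

lemma mid2 (n k : ℕ) : (2 * (k : ℝ) + 1) / 2 ^ (n + 1) ≤ ((k : ℝ) + 1) / 2 ^ n := by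
  rw [div_le_div_iff₀ (by positivity) (by positivity), pow_succ]
  have : (0 : ℝ) < 2 ^ n := by positivity
  nlinarith

lemma Phi_step (f : ℝ → ℝ → ℝ) (h0 : ∀ s, f s s = 0) (n : ℕ) (t : ℝ) :
    Phi f n t - Phi f (n + 1) t = ∑ k ∈ Finset.range (2 ^ n), ee f n k t := by
  unfold Phi
  rw [show 2 ^ (n + 1) = 2 * 2 ^ n by ring, sum_range_two_mul', ← Finset.sum_sub_distrib]
  refine Finset.sum_congr rfl fun k _ => ?_
  have e1 : (((2 * k : ℕ) : ℝ)) / 2 ^ (n + 1) = (k : ℝ) / 2 ^ n := by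
    push_cast; rw [pow_succ]; field_simp
  have e2 : (((2 * k + 1 : ℕ) : ℝ) + 1) / 2 ^ (n + 1) = ((k : ℝ) + 1) / 2 ^ n := by
    push_cast; rw [pow_succ]; field_simp; ring
  have e3 : (((2 * k : ℕ) : ℝ) + 1) / 2 ^ (n + 1) = (2 * (k : ℝ) + 1) / 2 ^ (n + 1) := by
    push_cast; rfl
  have e4 : (((2 * k + 1 : ℕ) : ℝ)) / 2 ^ (n + 1) = (2 * (k : ℝ) + 1) / 2 ^ (n + 1) := by
    push_cast; rfl
  rw [e1, e2, e3, e4]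
  unfold ee
  have a1 := mid1 n k
  have a2 := mid2 n k
  generalize (k : ℝ) / 2 ^ n = p at *
  generalize ((k : ℝ) + 1) / 2 ^ n = p' at *
  generalize (2 * (k : ℝ) + 1) / 2 ^ (n + 1) = q at *
  rcases le_total t q with h | h
  · have : cl p p' t = cl p q t := by
      unfold cl; rw [min_eq_left h, min_eq_left (h.trans a2)]
    rw [this, cl_left a2 h, h0]; ring
  · have : cl p p' t = cl q p' t := by
      have : q ≤ min t p' := le_min h a2
      unfold cl; rw [max_eq_right this, max_eq_right (a1.trans this)]
    rw [this, cl_right a1 h]; ring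

lemma cell_len (n k : ℕ) : ((k : ℝ) + 1) / 2 ^ n = (k : ℝ) / 2 ^ n + (1 / 2) ^ n := by
  rw [one_div, inv_pow]; field_simp

lemma two_bd {B κ ρ D x y : ℝ} (hB : 0 ≤ B) (hκ : 0 < κ) (hρ : 0 < ρ) (hD : 0 < D)
    (hx : |x| ≤ D) (hy : |y| ≤ D) : B * |x| ^ κ * |y| ^ ρ ≤ B * D ^ (κ + ρ) := by
  rw [Real.rpow_add hD, mul_assoc]
  gcongr

def Hyp (f : ℝ → ℝ → ℝ) (B κ ρ : ℝ) : Prop :=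
  ∀ a b c, |f a c - f a b - f b c| ≤ B * |b - a| ^ κ * |c - b| ^ ρ

lemma ee_bd {f : ℝ → ℝ → ℝ} {B κ ρ : ℝ} (hB : 0 ≤ B) (hκ : 0 < κ) (hρ : 0 < ρ)
    (hf : Hyp f B κ ρ) (n k : ℕ) (t : ℝ) :
    |ee f n k t| ≤ B * ((1 / 2 : ℝ) ^ n) ^ (κ + ρ) := by
  refine (hf _ _ _).trans (two_bd hB hκ hρ (by positivity) ?_ ?_)
  · have := mid1 n k; have := mid2 n k; have := cell_len n k
    rw [abs_le]; constructor <;> linarith [pow_pos (show (0 : ℝ) < 1 / 2 by norm_num) n]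
  · have := mid1 n k; have a2 := mid2 n k; have := cell_len n k
    have := le_cl ((2 * (k : ℝ) + 1) / 2 ^ (n + 1)) (((k : ℝ) + 1) / 2 ^ n) t
    have := cl_le t a2
    rw [abs_le]; constructor <;> linarith [pow_pos (show (0 : ℝ) < 1 / 2 by norm_num) n]

/-- the ratio -/
def rr (γ : ℝ) : ℝ := 2 * (1 / 2 : ℝ) ^ γ

lemma rr_pos (γ : ℝ) : 0 < rr γ := by unfold rr; positivity

lemma rr_lt {γ : ℝ} (h : 1 < γ) : rr γ < 1 := by
  have : (1 / 2 : ℝ) ^ γ < (1 / 2 : ℝ) ^ (1 : ℝ) :=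
    Real.rpow_lt_rpow_of_exponent_gt (by norm_num) (by norm_num) h
  rw [Real.rpow_one] at this
  unfold rr; linarith

lemma rr_pow (γ : ℝ) (n : ℕ) : (2 : ℝ) ^ n * ((1 / 2 : ℝ) ^ n) ^ γ = rr γ ^ n := by
  unfold rr
  rw [mul_pow, ← Real.rpow_natCast ((1 / 2 : ℝ) ^ γ), ← Real.rpow_natCast (1 / 2 : ℝ),
    ← Real.rpow_mul (by norm_num), ← Real.rpow_mul (by norm_num), mul_comm γ]

lemma Phi_step_bd {f : ℝ → ℝ → ℝ} {B κ ρ : ℝ} (hB : 0 ≤ B) (hκ : 0 < κ) (hρ : 0 < ρ)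
    (h0 : ∀ s, f s s = 0) (hf : Hyp f B κ ρ) (n : ℕ) (t : ℝ) :
    dist (Phi f n t) (Phi f (n + 1) t) ≤ B * rr (κ + ρ) ^ n := by
  rw [Real.dist_eq, Phi_step f h0, ← rr_pow]
  refine (Finset.abs_sum_le_sum_abs _ _).trans ?_
  refine (Finset.sum_le_card_nsmul _ _ _ fun k _ => ee_bd hB hκ hρ hf n k t).trans ?_
  simp only [Finset.card_range, nsmul_eq_mul]
  push_cast
  apply le_of_eq; ring

lemma Phi_cell_bd {f : ℝ → ℝ → ℝ} {B κ ρ : ℝ} (hB : 0 ≤ B) (hκ : 0 < κ) (hρ : 0 < ρ)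
    (h0 : ∀ s, f s s = 0) (hf : Hyp f B κ ρ) (m j i : ℕ) (s t : ℝ)
    (hs1 : (j : ℝ) / 2 ^ m ≤ s) (hs2 : s ≤ ((j : ℝ) + 1) / 2 ^ m)
    (ht1 : (j : ℝ) / 2 ^ m ≤ t) (ht2 : t ≤ ((j : ℝ) + 1) / 2 ^ m) :
    dist (Phi f (m + i) t - Phi f (m + i) s) (Phi f (m + (i + 1)) t - Phi f (m + (i + 1)) s)
      ≤ (2 * B * ((1 / 2 : ℝ) ^ m) ^ (κ + ρ)) * rr (κ + ρ) ^ i := by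
  rw [Real.dist_eq, ← add_assoc]
  have : Phi f (m + i) t - Phi f (m + i) s - (Phi f (m + i + 1) t - Phi f (m + i + 1) s)
      = ∑ k ∈ Finset.range (2 ^ (m + i)), (ee f (m + i) k t - ee f (m + i) k s) := by
    rw [Finset.sum_sub_distrib, ← Phi_step f h0, ← Phi_step f h0]; ring
  rw [this]
  have hz : ∀ k ∈ Finset.range (2 ^ (m + i)), k ∉ Finset.Ico (j * 2 ^ i) ((j + 1) * 2 ^ i) →
      |ee f (m + i) k t - ee f (m + i) k s| = 0 := by
    intro k _ hk
    have a2 := mid2 (m + i) k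
    have a1 := mid1 (m + i) k
    rw [abs_eq_zero, sub_eq_zero]
    rw [Finset.mem_Ico, not_and_or, not_le, not_lt] at hk
    unfold ee
    rcases hk with hk | hk
    · have : ((k : ℝ) + 1) / 2 ^ (m + i) ≤ (j : ℝ) / 2 ^ m := by
        rw [div_le_div_iff₀ (by positivity) (by positivity), pow_add]
        have : ((k : ℝ) + 1) ≤ (j : ℝ) * 2 ^ i := by exact_mod_cast hk
        have h2 : (0 : ℝ) < 2 ^ m := by positivity
        nlinarith
      rw [cl_right a2 (this.trans ht1), cl_right a2 (this.trans hs1)]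
    · have : ((j : ℝ) + 1) / 2 ^ m ≤ (k : ℝ) / 2 ^ (m + i) := by
        rw [div_le_div_iff₀ (by positivity) (by positivity), pow_add]
        have : ((j : ℝ) + 1) * 2 ^ i ≤ k := by exact_mod_cast hk
        have h2 : (0 : ℝ) < 2 ^ m := by positivity
        nlinarith
      rw [cl_left a2 ((ht2.trans this).trans a1), cl_left a2 ((hs2.trans this).trans a1)]
  refine (Finset.abs_sum_le_sum_abs _ _).trans ?_
  have hle : ∑ k ∈ Finset.range (2 ^ (m + i)), |ee f (m + i) k t - ee f (m + i) k s|
      ≤ ∑ k ∈ Finset.Ico (j * 2 ^ i) ((j + 1) * 2 ^ i),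
        |ee f (m + i) k t - ee f (m + i) k s| := by
    classical
    rw [← Finset.sum_filter_add_sum_filter_not (Finset.range (2 ^ (m + i)))
      (fun k => k ∈ Finset.Ico (j * 2 ^ i) ((j + 1) * 2 ^ i))]
    have : ∑ k ∈ Finset.range (2 ^ (m + i)) with k ∉ Finset.Ico (j * 2 ^ i) ((j + 1) * 2 ^ i),
        |ee f (m + i) k t - ee f (m + i) k s| = 0 := by
      refine Finset.sum_eq_zero fun k hk => ?_
      rw [Finset.mem_filter] at hk
      exact hz k hk.1 hk.2
    rw [this, add_zero]
    refine Finset.sum_le_sum_of_subset_of_nonneg ?_ (fun _ _ _ => abs_nonneg _)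
    intro k hk
    exact (Finset.mem_filter.1 hk).2
  refine hle.trans ?_
  have hb : ∀ k ∈ Finset.Ico (j * 2 ^ i) ((j + 1) * 2 ^ i),
      |ee f (m + i) k t - ee f (m + i) k s| ≤ 2 * (B * ((1 / 2 : ℝ) ^ (m + i)) ^ (κ + ρ)) := by
    intro k _
    have := ee_bd hB hκ hρ hf (m + i) k t
    have := ee_bd hB hκ hρ hf (m + i) k s
    refine (abs_sub _ _).trans ?_
    linarith
  refine (Finset.sum_le_card_nsmul _ _ _ hb).trans ?_
  rw [Nat.card_Ico, nsmul_eq_mul, ← Nat.sub_mul, Nat.add_sub_cancel_left, one_mul, ← rr_pow,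
    pow_add, Real.mul_rpow (by positivity) (by positivity)]
  push_cast
  apply le_of_eq; ring

lemma Phi_same {f : ℝ → ℝ → ℝ} 
    (h0 : ∀ s, f s s = 0) (m j : ℕ) (hj : j < 2 ^ m) (s t : ℝ)
    (hs1 : (j : ℝ) / 2 ^ m ≤ s) (hs2 : s ≤ ((j : ℝ) + 1) / 2 ^ m)
    (ht1 : (j : ℝ) / 2 ^ m ≤ t) (ht2 : t ≤ ((j : ℝ) + 1) / 2 ^ m) :
    Phi f m t - Phi f m s = f ((j : ℝ) / 2 ^ m) t - f ((j : ℝ) / 2 ^ m) s := by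
  unfold Phi
  rw [← Finset.sum_sub_distrib, Finset.sum_eq_single j]
  · rw [cl_mid ht1 ht2, cl_mid hs1 hs2]
  · intro k _ hk
    have a : (k : ℝ) / 2 ^ m ≤ ((k : ℝ) + 1) / 2 ^ m := by gcongr; linarith
    rcases lt_or_gt_of_ne hk with hk | hk
    · have : ((k : ℝ) + 1) / 2 ^ m ≤ (j : ℝ) / 2 ^ m := by
        gcongr; exact_mod_cast hk
      rw [cl_right a (this.trans ht1), cl_right a (this.trans hs1)]; ring
    · have : ((j : ℝ) + 1) / 2 ^ m ≤ (k : ℝ) / 2 ^ m := by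
        gcongr; exact_mod_cast hk
      rw [cl_left a (ht2.trans this), cl_left a (hs2.trans this)]; ring
  · intro h; exact absurd (Finset.mem_range.2 hj) h

def C0 (γ : ℝ) : ℝ := 1 + 2 / (1 - rr γ)

lemma C0_pos {γ : ℝ} (h : 1 < γ) : 0 < C0 γ := by
  have := rr_lt h
  have : 0 < 1 - rr γ := by linarith
  unfold C0; positivity

lemma same_cell {f : ℝ → ℝ → ℝ} {B κ ρ : ℝ} (hB : 0 ≤ B) (hκ : 0 < κ) (hρ : 0 < ρ)
    (hγ : 1 < κ + ρ) (h0 : ∀ s, f s s = 0) (hf : Hyp f B κ ρ) (φ : ℝ → ℝ)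
    (hφ : ∀ t, Tendsto (fun n => Phi f n t) atTop (𝓝 (φ t)))
    (m j : ℕ) (hj : j < 2 ^ m) (s t : ℝ)
    (hs1 : (j : ℝ) / 2 ^ m ≤ s) (hs2 : s ≤ ((j : ℝ) + 1) / 2 ^ m)
    (ht1 : (j : ℝ) / 2 ^ m ≤ t) (ht2 : t ≤ ((j : ℝ) + 1) / 2 ^ m) :
    |f s t - (φ t - φ s)| ≤ C0 (κ + ρ) * B * ((1 / 2 : ℝ) ^ m) ^ (κ + ρ) := by
  have hlim : Tendsto (fun i => Phi f (m + i) t - Phi f (m + i) s) atTop (𝓝 (φ t - φ s)) := by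
    have h := (hφ t).sub (hφ s)
    have h2 : Tendsto (fun i => m + i) atTop atTop := tendsto_atTop_mono (fun i => by simp) tendsto_id
    exact h.comp h2
  have key := dist_le_of_le_geometric_of_tendsto₀ (rr (κ + ρ))
    (2 * B * ((1 / 2 : ℝ) ^ m) ^ (κ + ρ)) (rr_lt hγ)
    (fun i => Phi_cell_bd hB hκ hρ h0 hf m j i s t hs1 hs2 ht1 ht2) hlim
  rw [add_zero, Real.dist_eq, Phi_same h0 m j hj s t hs1 hs2 ht1 ht2] at key
  have h1 := (hf ((j : ℝ) / 2 ^ m) s t).trans (two_bd hB hκ hρ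
    (show (0 : ℝ) < (1 / 2) ^ m by positivity)
    (by rw [abs_le]; have := cell_len m j; constructor <;> linarith)
    (by rw [abs_le]; have := cell_len m j; constructor <;> linarith))
  have : C0 (κ + ρ) * B * ((1 / 2 : ℝ) ^ m) ^ (κ + ρ) = B * ((1 / 2 : ℝ) ^ m) ^ (κ + ρ)
    + 2 * B * ((1 / 2 : ℝ) ^ m) ^ (κ + ρ) / (1 - rr (κ + ρ)) := by
    unfold C0; ring
  rw [this]
  rw [abs_le] at *
  constructor <;> linarith [h1.1, h1.2, key.1, key.2]

def CC (γ : ℝ) : ℝ := (2 * C0 γ + 1) * 2 ^ γ + 1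

lemma CC_pos {γ : ℝ} (h : 1 < γ) : 0 < CC γ := by
  have := C0_pos h
  unfold CC; positivity

lemma ordered_bd {f : ℝ → ℝ → ℝ} {B κ ρ : ℝ} (hB : 0 ≤ B) (hκ : 0 < κ) (hρ : 0 < ρ)
    (hγ : 1 < κ + ρ) (h0 : ∀ s, f s s = 0) (hf : Hyp f B κ ρ) (φ : ℝ → ℝ)
    (hφ : ∀ t, Tendsto (fun n => Phi f n t) atTop (𝓝 (φ t)))
    (s t : ℝ) (hs : 0 ≤ s) (hst : s < t) (ht : t ≤ 1) :
    |f s t - (φ t - φ s)| ≤ ((2 * C0 (κ + ρ) + 1) * 2 ^ (κ + ρ)) * B * (t - s) ^ (κ + ρ) := by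
  obtain ⟨m, hm1, hm2⟩ := exists_nat_pow_near_of_lt_one (x := t - s) (y := (1 / 2 : ℝ))
    (by linarith) (by linarith) (by norm_num) (by norm_num)
  have hD : (0 : ℝ) < (1 / 2) ^ m := by positivity
  have hC := C0_pos hγ
  have hmain : |f s t - (φ t - φ s)| ≤
      (2 * C0 (κ + ρ) + 1) * B * ((1 / 2 : ℝ) ^ m) ^ (κ + ρ) := by
    have hpos : (0 : ℝ) < 2 ^ m := by positivity
    set j := ⌊s * 2 ^ m⌋₊ with hjdef
    have hj1 : (j : ℝ) / 2 ^ m ≤ s := by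
      rw [div_le_iff₀ hpos]; exact Nat.floor_le (by positivity)
    have hj2 : s < ((j : ℝ) + 1) / 2 ^ m := by
      rw [lt_div_iff₀ hpos]; exact Nat.lt_floor_add_one _
    have hj : j < 2 ^ m := by
      have : (j : ℝ) < 2 ^ m := by
        have : (j : ℝ) / 2 ^ m < 1 := by linarith
        rwa [div_lt_one hpos] at this
      exact_mod_cast this
    have hX : 0 ≤ B * ((1 / 2 : ℝ) ^ m) ^ (κ + ρ) := by positivity
    rcases le_or_gt t (((j : ℝ) + 1) / 2 ^ m) with h | h
    · refine (same_cell hB hκ hρ hγ h0 hf φ hφ m j hj s t hj1 hj2.le (by linarith) h).trans ?_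
      nlinarith
    · have hj' : j + 1 < 2 ^ m := by
        have : (j : ℝ) + 1 < 2 ^ m := by
          have : ((j : ℝ) + 1) / 2 ^ m < 1 := by linarith
          rwa [div_lt_one hpos] at this
        exact_mod_cast this
      have hl := cell_len m j
      have hl' := cell_len m (j + 1)
      have hq : (j : ℝ) / 2 ^ m ≤ ((j : ℝ) + 1) / 2 ^ m := by linarith
      have A := same_cell hB hκ hρ hγ h0 hf φ hφ m j hj s (((j : ℝ) + 1) / 2 ^ m) hj1 hj2.le
        hq le_rfl
      push_cast at hl'
      have A' := same_cell hB hκ hρ hγ h0 hf φ hφ m (j + 1) hj' (((j : ℝ) + 1) / 2 ^ m) t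
        (by push_cast; exact le_rfl) (by push_cast; linarith) (by push_cast; linarith)
        (by push_cast; linarith)
      have h1 := (hf s (((j : ℝ) + 1) / 2 ^ m) t).trans (two_bd hB hκ hρ hD
        (by rw [abs_le]; constructor <;> linarith)
        (by rw [abs_le]; constructor <;> linarith))
      rw [show (2 * C0 (κ + ρ) + 1) * B * ((1 / 2 : ℝ) ^ m) ^ (κ + ρ)
        = C0 (κ + ρ) * B * ((1 / 2 : ℝ) ^ m) ^ (κ + ρ)
        + C0 (κ + ρ) * B * ((1 / 2 : ℝ) ^ m) ^ (κ + ρ)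
        + B * ((1 / 2 : ℝ) ^ m) ^ (κ + ρ) by ring]
      rw [abs_le] at *
      constructor <;> linarith [h1.1, h1.2, A.1, A.2, A'.1, A'.2]
  refine hmain.trans ?_
  have : ((1 / 2 : ℝ) ^ m) ^ (κ + ρ) ≤ 2 ^ (κ + ρ) * (t - s) ^ (κ + ρ) := by
    rw [← Real.mul_rpow (by norm_num) (by linarith)]
    apply Real.rpow_le_rpow hD.le _ (by linarith)
    rw [pow_succ] at hm1; linarith
  calc _ ≤ (2 * C0 (κ + ρ) + 1) * B * (2 ^ (κ + ρ) * (t - s) ^ (κ + ρ)) := by gcongr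
    _ = _ := by ring

lemma sew_bd {f : ℝ → ℝ → ℝ} {B κ ρ : ℝ} (hB : 0 ≤ B) (hκ : 0 < κ) (hρ : 0 < ρ)
    (hγ : 1 < κ + ρ) (h0 : ∀ s, f s s = 0) (hf : Hyp f B κ ρ) (φ : ℝ → ℝ)
    (hφ : ∀ t, Tendsto (fun n => Phi f n t) atTop (𝓝 (φ t)))
    (s t : ℝ) (hs : s ∈ I01) (ht : t ∈ I01) :
    |f s t - (φ t - φ s)| ≤ CC (κ + ρ) * B * |t - s| ^ (κ + ρ) := by
  have hX : 0 ≤ B * |t - s| ^ (κ + ρ) := by positivity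
  have hC := C0_pos hγ
  have e : CC (κ + ρ) * B * |t - s| ^ (κ + ρ) =
    ((2 * C0 (κ + ρ) + 1) * 2 ^ (κ + ρ)) * B * |t - s| ^ (κ + ρ) + B * |t - s| ^ (κ + ρ) := by
    unfold CC; ring
  rcases lt_trichotomy s t with h | h | h
  · have := ordered_bd hB hκ hρ hγ h0 hf φ hφ s t hs.1 h ht.2
    rw [← abs_of_pos (sub_pos.2 h)] at this
    linarith
  · subst h
    rw [h0, sub_self, sub_self, abs_zero]
    have := CC_pos hγ
    positivity
  · have := ordered_bd hB hκ hρ hγ h0 hf φ hφ t s ht.1 h hs.2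
    rw [← abs_of_pos (sub_pos.2 h), abs_sub_comm s t] at this
    have h2 := hf s t s
    rw [h0, mul_assoc, abs_sub_comm s t, ← Real.rpow_add (abs_pos.2 (by linarith))] at h2
    rw [e]
    rw [abs_le] at *
    constructor <;> linarith [h2.1, h2.2, this.1, this.2]

lemma sew {X : Type} [TopologicalSpace X] (G : X → ℝ → ℝ → ℝ) (B : X → ℝ) (B0 κ ρ : ℝ)
    (hG : Continuous fun q : X × ℝ × ℝ => G q.1 q.2.1 q.2.2)
    (hB : ∀ x, 0 ≤ B x) (hB0 : ∀ x, B x ≤ B0) (hκ : 0 < κ) (hρ : 0 < ρ)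
    (hγ : 1 < κ + ρ) (h0 : ∀ x s, G x s s = 0) (hf : ∀ x, Hyp (G x) (B x) κ ρ) :
    ∃ φ : X → ℝ → ℝ, (Continuous fun q : X × ℝ => φ q.1 q.2) ∧
      (∀ x t, Tendsto (fun n => Phi (G x) n t) atTop (𝓝 (φ x t))) ∧
      ∀ x, ∀ s ∈ I01, ∀ t ∈ I01,
        |G x s t - (φ x t - φ x s)| ≤ CC (κ + ρ) * B x * |t - s| ^ (κ + ρ) := by
  have hlim : ∀ x t, ∃ a, Tendsto (fun n => Phi (G x) n t) atTop (𝓝 a) := by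
    intro x t
    exact cauchySeq_tendsto_of_complete (cauchySeq_of_le_geometric (rr (κ + ρ)) (B x) (rr_lt hγ)
      (fun n => Phi_step_bd (hB x) hκ hρ (h0 x) (hf x) n t))
  choose φ hφ using hlim
  refine ⟨φ, ?_, hφ, fun x s hs t ht =>
    sew_bd (hB x) hκ hρ hγ (h0 x) (hf x) (φ x) (hφ x) s t hs ht⟩
  have hu : TendstoUniformly (fun n (q : X × ℝ) => Phi (G q.1) n q.2)
      (fun q => φ q.1 q.2) atTop := by
    rw [Metric.tendstoUniformly_iff]
    intro ε hε
    have : Tendsto (fun n => B0 * rr (κ + ρ) ^ n / (1 - rr (κ + ρ))) atTop (𝓝 0) := by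
      have := tendsto_pow_atTop_nhds_zero_of_lt_one (rr_pos (κ + ρ)).le (rr_lt hγ)
      have := (this.const_mul B0).div_const (1 - rr (κ + ρ))
      simpa using this
    filter_upwards [this.eventually_lt_const hε] with n hn q
    rw [dist_comm]
    refine lt_of_le_of_lt ?_ hn
    exact dist_le_of_le_geometric_of_tendsto (rr (κ + ρ)) B0 (rr_lt hγ)
      (fun n => (Phi_step_bd (hB q.1) hκ hρ (h0 q.1) (hf q.1) n q.2).trans
        (mul_le_mul_of_nonneg_right (hB0 q.1) (pow_nonneg (rr_pos _).le n))) (hφ q.1 q.2) n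
  refine hu.continuous (Frequently.of_forall fun n => ?_)
  unfold Phi
  refine continuous_finsetSum _ fun k _ => ?_
  exact hG.comp (continuous_fst.prodMk (continuous_const.prodMk ((cl_cont _ _).comp continuous_snd)))

def J (x : ℝ) : ℝ := cl 0 1 x

lemma J_mem (x : ℝ) : J x ∈ I01 := ⟨le_cl _ _ _, cl_le _ zero_le_one⟩

lemma J_eq {x : ℝ} (h : x ∈ I01) : J x = x := cl_mid h.1 h.2

lemma J_cont : Continuous J := cl_cont 0 1

lemma J_abs (x y : ℝ) : |J x - J y| ≤ |x - y| := cl_abs _ _ _ _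

lemma J_abs_one (x y : ℝ) : |J x - J y| ≤ 1 := by
  have h1 := J_mem x
  have h2 := J_mem y
  rw [abs_le]; constructor <;> linarith [h1.1, h1.2, h2.1, h2.2]

lemma M_nonneg {h : ℝ → ℝ → ℝ → ℝ → ℝ → ℝ → ℝ} {κ1 ρ1 κ2 ρ2 M : ℝ}
    (hh : ∀ (s1 s2 s3 t1 t2 t3 : I01),
        |h (s1 : ℝ) (s2 : ℝ) (s3 : ℝ) (t1 : ℝ) (t2 : ℝ) (t3 : ℝ)| ≤
          M * |(s2 : ℝ) - (s1 : ℝ)| ^ κ1 * |(s3 : ℝ) - (s2 : ℝ)| ^ ρ1 *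
            |(t2 : ℝ) - (t1 : ℝ)| ^ κ2 * |(t3 : ℝ) - (t2 : ℝ)| ^ ρ2) : 0 ≤ M := by
  have z : (0 : ℝ) ∈ I01 := ⟨le_rfl, zero_le_one⟩
  have o : (1 : ℝ) ∈ I01 := ⟨zero_le_one, le_rfl⟩
  have := hh ⟨0, z⟩ ⟨1, o⟩ ⟨0, z⟩ ⟨0, z⟩ ⟨1, o⟩ ⟨0, z⟩
  simp at this
  exact (abs_nonneg _).trans this

lemma coef_nonneg {M : ℝ} (hM : 0 ≤ M) (κ ρ a b c : ℝ) :
    0 ≤ M * |J b - J a| ^ κ * |J c - J b| ^ ρ := by positivity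

lemma coef_le {M κ ρ : ℝ} (hM : 0 ≤ M) (hκ : 0 < κ) (hρ : 0 < ρ) (a b c : ℝ) :
    M * |J b - J a| ^ κ * |J c - J b| ^ ρ ≤ M := by
  have h1 := Real.rpow_le_one (abs_nonneg _) (J_abs_one b a) hκ.le
  have h2 := Real.rpow_le_one (abs_nonneg _) (J_abs_one c b) hρ.le
  calc _ ≤ M * 1 * 1 := by gcongr
    _ = M := by ring

lemma J_rpow {κ : ℝ} (hκ : 0 < κ) (a b : ℝ) : |J b - J a| ^ κ ≤ |b - a| ^ κ :=
  Real.rpow_le_rpow (abs_nonneg _) (J_abs _ _) hκ.le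

lemma part1 {h : ℝ → ℝ → ℝ → ℝ → ℝ → ℝ → ℝ} {g0 : ℝ → ℝ → ℝ → ℝ → ℝ → ℝ} {κ1 ρ1 κ2 ρ2 M : ℝ}
    (hγ : 1 < κ1 + ρ1) (hg0 : MemP23 g0)
    (hd : ∀ (s1 s2 s3 t1 t2 t3 : I01),
        del1of23 g0 (s1 : ℝ) (s2 : ℝ) (s3 : ℝ) (t1 : ℝ) (t2 : ℝ) (t3 : ℝ) =
          h (s1 : ℝ) (s2 : ℝ) (s3 : ℝ) (t1 : ℝ) (t2 : ℝ) (t3 : ℝ))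
    (hκ1 : 0 < κ1) (hρ1 : 0 < ρ1) (hκ2 : 0 < κ2) (hρ2 : 0 < ρ2)
    (hh : ∀ (s1 s2 s3 t1 t2 t3 : I01),
        |h (s1 : ℝ) (s2 : ℝ) (s3 : ℝ) (t1 : ℝ) (t2 : ℝ) (t3 : ℝ)| ≤
          M * |(s2 : ℝ) - (s1 : ℝ)| ^ κ1 * |(s3 : ℝ) - (s2 : ℝ)| ^ ρ1 *
            |(t2 : ℝ) - (t1 : ℝ)| ^ κ2 * |(t3 : ℝ) - (t2 : ℝ)| ^ ρ2) :
    ∃ φ : ℝ × ℝ × ℝ → ℝ → ℝ, (Continuous fun q : (ℝ × ℝ × ℝ) × ℝ => φ q.1 q.2) ∧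
      (∀ x t, Tendsto (fun n =>
        Phi (fun s s' => g0 (J s) (J s') (J x.1) (J x.2.1) (J x.2.2)) n t) atTop (𝓝 (φ x t))) ∧
      ∀ s1 ∈ I01, ∀ s2 ∈ I01, ∀ t1 ∈ I01, ∀ t2 ∈ I01, ∀ t3 ∈ I01,
        |g0 s1 s2 t1 t2 t3 - (φ (t1, t2, t3) s2 - φ (t1, t2, t3) s1)| ≤
          CC (κ1 + ρ1) * M * |s2 - s1| ^ (κ1 + ρ1) * |t2 - t1| ^ κ2 * |t3 - t2| ^ ρ2 := by
  have hM := M_nonneg hh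
  obtain ⟨φ, hc, ht, hb⟩ := sew
    (fun (x : ℝ × ℝ × ℝ) s s' => g0 (J s) (J s') (J x.1) (J x.2.1) (J x.2.2))
    (fun x => M * |J x.2.1 - J x.1| ^ κ2 * |J x.2.2 - J x.2.1| ^ ρ2) M κ1 ρ1
    (by
      have := J_cont
      refine hg0.1.comp_continuous (f := fun q : (ℝ × ℝ × ℝ) × ℝ × ℝ =>
        (J q.2.1, J q.2.2, J q.1.1, J q.1.2.1, J q.1.2.2)) (by fun_prop) ?_
      intro q
      exact ⟨J_mem _, J_mem _, J_mem _, J_mem _, J_mem _⟩)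
    (fun x => coef_nonneg hM _ _ _ _ _) (fun x => coef_le hM hκ2 hρ2 _ _ _) hκ1 hρ1 hγ
    (fun x s => hg0.2 ⟨_, J_mem s⟩ ⟨_, J_mem s⟩ ⟨_, J_mem x.1⟩ ⟨_, J_mem x.2.1⟩ ⟨_, J_mem x.2.2⟩
      (Or.inl rfl))
    (fun x a b c => by
      have h1 := hd ⟨_, J_mem a⟩ ⟨_, J_mem b⟩ ⟨_, J_mem c⟩
        ⟨_, J_mem x.1⟩ ⟨_, J_mem x.2.1⟩ ⟨_, J_mem x.2.2⟩
      have h2 := hh ⟨_, J_mem a⟩ ⟨_, J_mem b⟩ ⟨_, J_mem c⟩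
        ⟨_, J_mem x.1⟩ ⟨_, J_mem x.2.1⟩ ⟨_, J_mem x.2.2⟩
      rw [← h1] at h2
      refine h2.trans ?_
      have := J_rpow hκ1 a b
      have := J_rpow hρ1 b c
      dsimp only
      calc _ ≤ M * |b - a| ^ κ1 * |c - b| ^ ρ1 *
            |J x.2.1 - J x.1| ^ κ2 * |J x.2.2 - J x.2.1| ^ ρ2 := by gcongr
        _ = _ := by ring)
  refine ⟨φ, hc, ht, ?_⟩
  intro s1 h1 s2 h2 t1 k1 t2 k2 t3 k3
  have := hb (t1, t2, t3) s1 h1 s2 h2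
  simp only [J_eq h1, J_eq h2, J_eq k1, J_eq k2, J_eq k3] at this
  refine this.trans (le_of_eq ?_)
  ring

lemma part2 {h : ℝ → ℝ → ℝ → ℝ → ℝ → ℝ → ℝ} {g0 : ℝ → ℝ → ℝ → ℝ → ℝ → ℝ} {κ1 ρ1 κ2 ρ2 M : ℝ}
    (hγ : 1 < κ2 + ρ2) (hg0 : MemP32 g0)
    (hd : ∀ (s1 s2 s3 t1 t2 t3 : I01),
        del2of32 g0 (s1 : ℝ) (s2 : ℝ) (s3 : ℝ) (t1 : ℝ) (t2 : ℝ) (t3 : ℝ) =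
          h (s1 : ℝ) (s2 : ℝ) (s3 : ℝ) (t1 : ℝ) (t2 : ℝ) (t3 : ℝ))
    (hκ1 : 0 < κ1) (hρ1 : 0 < ρ1) (hκ2 : 0 < κ2) (hρ2 : 0 < ρ2)
    (hh : ∀ (s1 s2 s3 t1 t2 t3 : I01),
        |h (s1 : ℝ) (s2 : ℝ) (s3 : ℝ) (t1 : ℝ) (t2 : ℝ) (t3 : ℝ)| ≤
          M * |(s2 : ℝ) - (s1 : ℝ)| ^ κ1 * |(s3 : ℝ) - (s2 : ℝ)| ^ ρ1 *
            |(t2 : ℝ) - (t1 : ℝ)| ^ κ2 * |(t3 : ℝ) - (t2 : ℝ)| ^ ρ2) :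
    ∃ φ : ℝ × ℝ × ℝ → ℝ → ℝ, (Continuous fun q : (ℝ × ℝ × ℝ) × ℝ => φ q.1 q.2) ∧
      ∀ s1 ∈ I01, ∀ s2 ∈ I01, ∀ s3 ∈ I01, ∀ t1 ∈ I01, ∀ t2 ∈ I01, 
        |g0 s1 s2 s3 t1 t2 - (φ (s1, s2, s3) t2 - φ (s1, s2, s3) t1)| ≤
          CC (κ2 + ρ2) * M * |s2 - s1| ^ κ1 * |s3 - s2| ^ ρ1 * |t2 - t1| ^ (κ2 + ρ2) := by
  have hM := M_nonneg hh
  obtain ⟨φ, hc, ht, hb⟩ := sew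
    (fun (x : ℝ × ℝ × ℝ) s s' => g0 (J x.1) (J x.2.1) (J x.2.2) (J s) (J s'))
    (fun x => M * |J x.2.1 - J x.1| ^ κ1 * |J x.2.2 - J x.2.1| ^ ρ1) M κ2 ρ2
    (by
      have := J_cont
      refine hg0.1.comp_continuous (f := fun q : (ℝ × ℝ × ℝ) × ℝ × ℝ =>
        (J q.1.1, J q.1.2.1, J q.1.2.2, J q.2.1, J q.2.2)) (by fun_prop) ?_
      intro q
      exact ⟨J_mem _, J_mem _, J_mem _, J_mem _, J_mem _⟩)
    (fun x => coef_nonneg hM _ _ _ _ _) (fun x => coef_le hM hκ1 hρ1 _ _ _) hκ2 hρ2 hγ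
    (fun x s => hg0.2 ⟨_, J_mem x.1⟩ ⟨_, J_mem x.2.1⟩ ⟨_, J_mem x.2.2⟩ ⟨_, J_mem s⟩ ⟨_, J_mem s⟩
      (Or.inr (Or.inr rfl)))
    (fun x a b c => by
      have h1 := hd ⟨_, J_mem x.1⟩ ⟨_, J_mem x.2.1⟩ ⟨_, J_mem x.2.2⟩
        ⟨_, J_mem a⟩ ⟨_, J_mem b⟩ ⟨_, J_mem c⟩
      have h2 := hh ⟨_, J_mem x.1⟩ ⟨_, J_mem x.2.1⟩ ⟨_, J_mem x.2.2⟩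
        ⟨_, J_mem a⟩ ⟨_, J_mem b⟩ ⟨_, J_mem c⟩
      rw [← h1] at h2
      refine h2.trans ?_
      have := J_rpow hκ2 a b
      have := J_rpow hρ2 b c
      dsimp only
      gcongr)
  refine ⟨φ, hc, ?_⟩
  intro s1 h1 s2 h2 t1 k1 t2 k2 t3 k3
  have := hb (s1, s2, t1) t2 k2 t3 k3
  simp only [J_eq h1, J_eq h2, J_eq k1, J_eq k2, J_eq k3] at this
  refine this.trans (le_of_eq ?_)
  ring

lemma Phi_cocycle {f1 f2 f3 f4 : ℝ → ℝ → ℝ}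
    (hf : ∀ a b, f1 a b = f2 a b - f3 a b + f4 a b) (n : ℕ) (t : ℝ) :
    Phi f1 n t = Phi f2 n t - Phi f3 n t + Phi f4 n t := by
  unfold Phi
  rw [← Finset.sum_sub_distrib, ← Finset.sum_add_distrib]
  exact Finset.sum_congr rfl fun k _ => hf _ _

lemma part3 {h : ℝ → ℝ → ℝ → ℝ → ℝ → ℝ → ℝ} {g0 : ℝ → ℝ → ℝ → ℝ → ℝ} {κ1 ρ1 κ2 ρ2 M : ℝ}
    (hγ1 : 1 < κ1 + ρ1) (hγ2 : 1 < κ2 + ρ2) (hg0 : MemP22 g0)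
    (hd : ∀ (s1 s2 s3 t1 t2 t3 : I01),
        delFull g0 (s1 : ℝ) (s2 : ℝ) (s3 : ℝ) (t1 : ℝ) (t2 : ℝ) (t3 : ℝ) =
          h (s1 : ℝ) (s2 : ℝ) (s3 : ℝ) (t1 : ℝ) (t2 : ℝ) (t3 : ℝ))
    (hκ1 : 0 < κ1) (hρ1 : 0 < ρ1) (hκ2 : 0 < κ2) (hρ2 : 0 < ρ2)
    (hh : ∀ (s1 s2 s3 t1 t2 t3 : I01),
        |h (s1 : ℝ) (s2 : ℝ) (s3 : ℝ) (t1 : ℝ) (t2 : ℝ) (t3 : ℝ)| ≤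
          M * |(s2 : ℝ) - (s1 : ℝ)| ^ κ1 * |(s3 : ℝ) - (s2 : ℝ)| ^ ρ1 *
            |(t2 : ℝ) - (t1 : ℝ)| ^ κ2 * |(t3 : ℝ) - (t2 : ℝ)| ^ ρ2) :
    ∃ g, MemP22 g ∧
        (∀ (s1 s2 s3 t1 t2 t3 : I01),
          delFull g (s1 : ℝ) (s2 : ℝ) (s3 : ℝ) (t1 : ℝ) (t2 : ℝ) (t3 : ℝ) =
            h (s1 : ℝ) (s2 : ℝ) (s3 : ℝ) (t1 : ℝ) (t2 : ℝ) (t3 : ℝ)) ∧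
        (∀ (s1 s2 t1 t2 : I01),
          |g (s1 : ℝ) (s2 : ℝ) (t1 : ℝ) (t2 : ℝ)| ≤
            (CC (κ2 + ρ2) * CC (κ1 + ρ1)) * M * |(s2 : ℝ) - (s1 : ℝ)| ^ (κ1 + ρ1) *
              |(t2 : ℝ) - (t1 : ℝ)| ^ (κ2 + ρ2)) := by
  have hM := M_nonneg hh
  have hC1 := CC_pos hγ1
  have z : (0 : ℝ) ∈ I01 := ⟨le_rfl, zero_le_one⟩
  have hv := hg0.2
  have hf0 : MemP23 (del2of22 g0) := by
    constructor
    · unfold del2of22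
      have c := hg0.1
      refine ContinuousOn.sub (ContinuousOn.sub ?_ ?_) ?_
      · refine c.comp (f := fun q : ℝ × ℝ × ℝ × ℝ × ℝ => (q.1, q.2.1, q.2.2.1, q.2.2.2.2))
          (by fun_prop) ?_
        rintro q ⟨h1, h2, h3, h4, h5⟩; exact ⟨h1, h2, h3, h5⟩
      · refine c.comp (f := fun q : ℝ × ℝ × ℝ × ℝ × ℝ => (q.1, q.2.1, q.2.2.1, q.2.2.2.1))
          (by fun_prop) ?_
        rintro q ⟨h1, h2, h3, h4, h5⟩; exact ⟨h1, h2, h3, h4⟩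
      · refine c.comp (f := fun q : ℝ × ℝ × ℝ × ℝ × ℝ => (q.1, q.2.1, q.2.2.2.1, q.2.2.2.2))
          (by fun_prop) ?_
        rintro q ⟨h1, h2, h3, h4, h5⟩; exact ⟨h1, h2, h4, h5⟩
    · intro s1 s2 t1 t2 t3 hor
      unfold del2of22
      rcases hor with e | e | e
      · rw [hv s1 s2 t1 t3 (Or.inl e), hv s1 s2 t1 t2 (Or.inl e), hv s1 s2 t2 t3 (Or.inl e)]; ring
      · rw [hv s1 s2 t1 t2 (Or.inr e), e]; ring
      · rw [hv s1 s2 t2 t3 (Or.inr e), e]; ring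
  obtain ⟨φ, hφc, hφt, hφb⟩ := part1 (g0 := del2of22 g0) hγ1 hf0 hd hκ1 hρ1 hκ2 hρ2 hh
  have coc : ∀ t1 t2 t3 s, φ (t1, t2, t3) s =
      φ (0, t2, t3) s - φ (0, t1, t3) s + φ (0, t1, t2) s := by
    intro t1 t2 t3 s
    refine tendsto_nhds_unique (hφt (t1, t2, t3) s) ?_
    refine (((hφt (0, t2, t3) s).sub (hφt (0, t1, t3) s)).add (hφt (0, t1, t2) s)).congr
      fun n => ?_
    refine (Phi_cocycle (fun a b => ?_) n s).symm
    simp only [del2of22]; ring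
  -- `g1 = δ₂ k`
  set g1 : ℝ → ℝ → ℝ → ℝ → ℝ → ℝ := fun s1 s2 t1 t2 t3 =>
    del2of22 g0 s1 s2 t1 t2 t3 - (φ (t1, t2, t3) s2 - φ (t1, t2, t3) s1) with hg1
  set k : ℝ → ℝ → ℝ → ℝ → ℝ := fun s1 s2 a b => - g1 s1 s2 0 a b with hk
  have hδk : ∀ s1 s2 t1 t2 t3, k s1 s2 t1 t3 - k s1 s2 t1 t2 - k s1 s2 t2 t3
      = g1 s1 s2 t1 t2 t3 := by
    intro s1 s2 t1 t2 t3
    simp only [hk, hg1, coc t1 t2 t3 s1, coc t1 t2 t3 s2, del2of22]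
    ring
  have hk0 : ∀ s1 ∈ I01, ∀ s2 ∈ I01, ∀ t ∈ I01, k s1 s2 t t = 0 := by
    intro s1 h1 s2 h2 t ht
    have := hφb s1 h1 s2 h2 0 z t ht t ht
    rw [sub_self t, abs_zero, Real.zero_rpow hρ2.ne', mul_zero] at this
    have := abs_eq_zero.1 (le_antisymm this (abs_nonneg _))
    simp only [hk, hg1, this, neg_zero]
  obtain ⟨ψ, hψc, -, hψb⟩ := sew
    (fun (x : ℝ × ℝ) t t' => k (J x.1) (J x.2) (J t) (J t'))
    (fun x => CC (κ1 + ρ1) * M * |J x.2 - J x.1| ^ (κ1 + ρ1)) (CC (κ1 + ρ1) * M) κ2 ρ2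
    (by
      have := J_cont
      simp only [hk, hg1]
      refine Continuous.neg (Continuous.sub ?_ (Continuous.sub ?_ ?_))
      · refine hf0.1.comp_continuous (f := fun q : (ℝ × ℝ) × ℝ × ℝ =>
          (J q.1.1, J q.1.2, 0, J q.2.1, J q.2.2)) (by fun_prop) ?_
        intro q
        exact ⟨J_mem _, J_mem _, z, J_mem _, J_mem _⟩
      · exact hφc.comp (f := fun q : (ℝ × ℝ) × ℝ × ℝ =>
          (((0 : ℝ), J q.2.1, J q.2.2), J q.1.2)) (by fun_prop)
      · exact hφc.comp (f := fun q : (ℝ × ℝ) × ℝ × ℝ =>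
          (((0 : ℝ), J q.2.1, J q.2.2), J q.1.1)) (by fun_prop))
    (fun x => by positivity)
    (fun x => by
      have := Real.rpow_le_one (abs_nonneg _) (J_abs_one x.2 x.1) (show 0 ≤ κ1 + ρ1 by linarith)
      have h0 : 0 ≤ CC (κ1 + ρ1) * M := by positivity
      nlinarith)
    hκ2 hρ2 hγ2
    (fun x s => hk0 _ (J_mem _) _ (J_mem _) _ (J_mem _))
    (fun x a b c => by
      dsimp only
      rw [hδk]
      refine (hφb _ (J_mem _) _ (J_mem _) _ (J_mem _) _ (J_mem _) _ (J_mem _)).trans ?_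
      have := J_rpow hκ2 a b
      have := J_rpow hρ2 b c
      gcongr)
  set g : ℝ → ℝ → ℝ → ℝ → ℝ := fun s1 s2 t1 t2 =>
    k s1 s2 t1 t2 - (ψ (s1, s2) t2 - ψ (s1, s2) t1) with hg
  have bound : ∀ (s1 s2 t1 t2 : I01),
          |g (s1 : ℝ) (s2 : ℝ) (t1 : ℝ) (t2 : ℝ)| ≤
            (CC (κ2 + ρ2) * CC (κ1 + ρ1)) * M * |(s2 : ℝ) - (s1 : ℝ)| ^ (κ1 + ρ1) *
              |(t2 : ℝ) - (t1 : ℝ)| ^ (κ2 + ρ2) := by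
    rintro ⟨s1, h1⟩ ⟨s2, h2⟩ ⟨t1, k1⟩ ⟨t2, k2⟩
    have := hψb (s1, s2) t1 k1 t2 k2
    simp only [J_eq h1, J_eq h2, J_eq k1, J_eq k2] at this
    refine this.trans (le_of_eq ?_)
    ring
  refine ⟨g, ⟨?_, ?_⟩, ?_, bound⟩
  · simp only [hg, hk, hg1]
    refine ContinuousOn.sub (ContinuousOn.neg (ContinuousOn.sub ?_ ?_)) ?_
    · refine hf0.1.comp (f := fun q : ℝ × ℝ × ℝ × ℝ =>
          (q.1, q.2.1, 0, q.2.2.1, q.2.2.2)) (by fun_prop) ?_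
      rintro q ⟨h1, h2, h3, h4⟩
      exact ⟨h1, h2, z, h3, h4⟩
    · refine (Continuous.sub ?_ ?_).continuousOn
      · exact hφc.comp (f := fun q : ℝ × ℝ × ℝ × ℝ =>
          (((0 : ℝ), q.2.2.1, q.2.2.2), q.2.1)) (by fun_prop)
      · exact hφc.comp (f := fun q : ℝ × ℝ × ℝ × ℝ =>
          (((0 : ℝ), q.2.2.1, q.2.2.2), q.1)) (by fun_prop)
    · refine (Continuous.sub ?_ ?_).continuousOn
      · exact hψc.comp (f := fun q : ℝ × ℝ × ℝ × ℝ =>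
          ((q.1, q.2.1), q.2.2.2)) (by fun_prop)
      · exact hψc.comp (f := fun q : ℝ × ℝ × ℝ × ℝ =>
          ((q.1, q.2.1), q.2.2.1)) (by fun_prop)
  · intro s1 s2 t1 t2 hor
    have hb := bound s1 s2 t1 t2
    refine abs_eq_zero.1 (le_antisymm (hb.trans (le_of_eq ?_)) (abs_nonneg _))
    rcases hor with e | e
    · rw [e, sub_self, abs_zero, Real.zero_rpow (by linarith)]; ring
    · rw [e, sub_self, abs_zero, Real.zero_rpow (by linarith)]; ring
  · intro s1 s2 s3 t1 t2 t3
    rw [← hd]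
    have e : ∀ a b, del2of22 g a b t1 t2 t3 = g1 a b t1 t2 t3 := by
      intro a b
      rw [← hδk]
      simp only [del2of22, hg]; ring
    unfold delFull
    rw [e, e, e]
    simp only [hg1]; ring

/-- Planar sewing maps `Λ₁`, `Λ₂` and `Λ`. -/
theorem planar_sewing_maps (γ1 γ2 : ℝ) (hγ1 : 1 < γ1) (hγ2 : 1 < γ2) :
    -- (1) the map Λ₁
    (∃ c1 : ℝ, ∀ (h : ℝ → ℝ → ℝ → ℝ → ℝ → ℝ → ℝ) (κ1 ρ1 κ2 ρ2 M : ℝ),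
      MemP33 h →
      (∃ g0, MemP23 g0 ∧ ∀ (s1 s2 s3 t1 t2 t3 : I01),
        del1of23 g0 (s1 : ℝ) (s2 : ℝ) (s3 : ℝ) (t1 : ℝ) (t2 : ℝ) (t3 : ℝ) =
          h (s1 : ℝ) (s2 : ℝ) (s3 : ℝ) (t1 : ℝ) (t2 : ℝ) (t3 : ℝ)) →
      0 < κ1 → 0 < ρ1 → κ1 + ρ1 = γ1 → 0 < κ2 → 0 < ρ2 → κ2 + ρ2 = γ2 →
      (∀ (s1 s2 s3 t1 t2 t3 : I01),
        |h (s1 : ℝ) (s2 : ℝ) (s3 : ℝ) (t1 : ℝ) (t2 : ℝ) (t3 : ℝ)| ≤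
          M * |(s2 : ℝ) - (s1 : ℝ)| ^ κ1 * |(s3 : ℝ) - (s2 : ℝ)| ^ ρ1 *
            |(t2 : ℝ) - (t1 : ℝ)| ^ κ2 * |(t3 : ℝ) - (t2 : ℝ)| ^ ρ2) →
      ∃ g, MemP23 g ∧
        (∀ (s1 s2 s3 t1 t2 t3 : I01),
          del1of23 g (s1 : ℝ) (s2 : ℝ) (s3 : ℝ) (t1 : ℝ) (t2 : ℝ) (t3 : ℝ) =
            h (s1 : ℝ) (s2 : ℝ) (s3 : ℝ) (t1 : ℝ) (t2 : ℝ) (t3 : ℝ)) ∧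
        (∀ (s1 s2 t1 t2 t3 : I01),
          |g (s1 : ℝ) (s2 : ℝ) (t1 : ℝ) (t2 : ℝ) (t3 : ℝ)| ≤
            c1 * M * |(s2 : ℝ) - (s1 : ℝ)| ^ γ1 *
              |(t2 : ℝ) - (t1 : ℝ)| ^ κ2 * |(t3 : ℝ) - (t2 : ℝ)| ^ ρ2)) ∧
    -- (1') the map Λ₂, with the roles of the two directions exchanged
    (∃ c2 : ℝ, ∀ (h : ℝ → ℝ → ℝ → ℝ → ℝ → ℝ → ℝ) (κ1 ρ1 κ2 ρ2 M : ℝ),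
      MemP33 h →
      (∃ g0, MemP32 g0 ∧ ∀ (s1 s2 s3 t1 t2 t3 : I01),
        del2of32 g0 (s1 : ℝ) (s2 : ℝ) (s3 : ℝ) (t1 : ℝ) (t2 : ℝ) (t3 : ℝ) =
          h (s1 : ℝ) (s2 : ℝ) (s3 : ℝ) (t1 : ℝ) (t2 : ℝ) (t3 : ℝ)) →
      0 < κ1 → 0 < ρ1 → κ1 + ρ1 = γ1 → 0 < κ2 → 0 < ρ2 → κ2 + ρ2 = γ2 →
      (∀ (s1 s2 s3 t1 t2 t3 : I01),
        |h (s1 : ℝ) (s2 : ℝ) (s3 : ℝ) (t1 : ℝ) (t2 : ℝ) (t3 : ℝ)| ≤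
          M * |(s2 : ℝ) - (s1 : ℝ)| ^ κ1 * |(s3 : ℝ) - (s2 : ℝ)| ^ ρ1 *
            |(t2 : ℝ) - (t1 : ℝ)| ^ κ2 * |(t3 : ℝ) - (t2 : ℝ)| ^ ρ2) →
      ∃ g, MemP32 g ∧
        (∀ (s1 s2 s3 t1 t2 t3 : I01),
          del2of32 g (s1 : ℝ) (s2 : ℝ) (s3 : ℝ) (t1 : ℝ) (t2 : ℝ) (t3 : ℝ) =
            h (s1 : ℝ) (s2 : ℝ) (s3 : ℝ) (t1 : ℝ) (t2 : ℝ) (t3 : ℝ)) ∧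
        (∀ (s1 s2 s3 t1 t2 : I01),
          |g (s1 : ℝ) (s2 : ℝ) (s3 : ℝ) (t1 : ℝ) (t2 : ℝ)| ≤
            c2 * M * |(s2 : ℝ) - (s1 : ℝ)| ^ κ1 * |(s3 : ℝ) - (s2 : ℝ)| ^ ρ1 *
              |(t2 : ℝ) - (t1 : ℝ)| ^ γ2)) ∧
    -- (2) the map Λ
    (∃ c3 : ℝ, ∀ (h : ℝ → ℝ → ℝ → ℝ → ℝ → ℝ → ℝ) (κ1 ρ1 κ2 ρ2 M : ℝ),
      MemP33 h →
      (∃ g0, MemP22 g0 ∧ ∀ (s1 s2 s3 t1 t2 t3 : I01),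
        delFull g0 (s1 : ℝ) (s2 : ℝ) (s3 : ℝ) (t1 : ℝ) (t2 : ℝ) (t3 : ℝ) =
          h (s1 : ℝ) (s2 : ℝ) (s3 : ℝ) (t1 : ℝ) (t2 : ℝ) (t3 : ℝ)) →
      0 < κ1 → 0 < ρ1 → κ1 + ρ1 = γ1 → 0 < κ2 → 0 < ρ2 → κ2 + ρ2 = γ2 →
      (∀ (s1 s2 s3 t1 t2 t3 : I01),
        |h (s1 : ℝ) (s2 : ℝ) (s3 : ℝ) (t1 : ℝ) (t2 : ℝ) (t3 : ℝ)| ≤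
          M * |(s2 : ℝ) - (s1 : ℝ)| ^ κ1 * |(s3 : ℝ) - (s2 : ℝ)| ^ ρ1 *
            |(t2 : ℝ) - (t1 : ℝ)| ^ κ2 * |(t3 : ℝ) - (t2 : ℝ)| ^ ρ2) →
      ∃ g, MemP22 g ∧
        (∀ (s1 s2 s3 t1 t2 t3 : I01),
          delFull g (s1 : ℝ) (s2 : ℝ) (s3 : ℝ) (t1 : ℝ) (t2 : ℝ) (t3 : ℝ) =
            h (s1 : ℝ) (s2 : ℝ) (s3 : ℝ) (t1 : ℝ) (t2 : ℝ) (t3 : ℝ)) ∧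
        (∀ (s1 s2 t1 t2 : I01),
          |g (s1 : ℝ) (s2 : ℝ) (t1 : ℝ) (t2 : ℝ)| ≤
            c3 * M * |(s2 : ℝ) - (s1 : ℝ)| ^ γ1 * |(t2 : ℝ) - (t1 : ℝ)| ^ γ2)) := by
  refine ⟨⟨CC γ1, ?_⟩, ⟨CC γ2, ?_⟩, ⟨CC γ2 * CC γ1, ?_⟩⟩
  · rintro h κ1 ρ1 κ2 ρ2 M - ⟨g0, hg0, hd⟩ hκ1 hρ1 rfl hκ2 hρ2 rfl hh
    obtain ⟨φ, hc, -, hb⟩ := part1 hγ1 hg0 hd hκ1 hρ1 hκ2 hρ2 hh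
    have bound := fun (s1 s2 t1 t2 t3 : I01) =>
      hb s1 s1.2 s2 s2.2 t1 t1.2 t2 t2.2 t3 t3.2
    refine ⟨fun s1 s2 t1 t2 t3 =>
      g0 s1 s2 t1 t2 t3 - (φ (t1, t2, t3) s2 - φ (t1, t2, t3) s1), ⟨?_, ?_⟩, ?_, bound⟩
    · refine hg0.1.sub (Continuous.sub ?_ ?_).continuousOn
      · exact hc.comp (f := fun q : ℝ × ℝ × ℝ × ℝ × ℝ =>
          ((q.2.2.1, q.2.2.2.1, q.2.2.2.2), q.2.1)) (by fun_prop)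
      · exact hc.comp (f := fun q : ℝ × ℝ × ℝ × ℝ × ℝ =>
          ((q.2.2.1, q.2.2.2.1, q.2.2.2.2), q.1)) (by fun_prop)
    · intro s1 s2 t1 t2 t3 hor
      refine abs_eq_zero.1 (le_antisymm ((bound s1 s2 t1 t2 t3).trans (le_of_eq ?_))
        (abs_nonneg _))
      rcases hor with e | e | e
      · rw [e, sub_self, abs_zero, Real.zero_rpow (by linarith)]; ring
      · rw [e, sub_self, abs_zero, Real.zero_rpow (by linarith)]; ring
      · rw [e, sub_self, abs_zero, Real.zero_rpow (by linarith)]; ring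
    · intro s1 s2 s3 t1 t2 t3
      rw [← hd]
      simp only [del1of23]; ring
  · rintro h κ1 ρ1 κ2 ρ2 M - ⟨g0, hg0, hd⟩ hκ1 hρ1 rfl hκ2 hρ2 rfl hh
    obtain ⟨φ, hc, hb⟩ := part2 hγ2 hg0 hd hκ1 hρ1 hκ2 hρ2 hh
    have bound := fun (s1 s2 s3 t1 t2 : I01) =>
      hb s1 s1.2 s2 s2.2 s3 s3.2 t1 t1.2 t2 t2.2
    refine ⟨fun s1 s2 s3 t1 t2 =>
      g0 s1 s2 s3 t1 t2 - (φ (s1, s2, s3) t2 - φ (s1, s2, s3) t1), ⟨?_, ?_⟩, ?_, bound⟩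
    · refine hg0.1.sub (Continuous.sub ?_ ?_).continuousOn
      · exact hc.comp (f := fun q : ℝ × ℝ × ℝ × ℝ × ℝ =>
          ((q.1, q.2.1, q.2.2.1), q.2.2.2.2)) (by fun_prop)
      · exact hc.comp (f := fun q : ℝ × ℝ × ℝ × ℝ × ℝ =>
          ((q.1, q.2.1, q.2.2.1), q.2.2.2.1)) (by fun_prop)
    · intro s1 s2 s3 t1 t2 hor
      refine abs_eq_zero.1 (le_antisymm ((bound s1 s2 s3 t1 t2).trans (le_of_eq ?_))
        (abs_nonneg _))
      rcases hor with e | e | e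
      · rw [e, sub_self, abs_zero, Real.zero_rpow (by linarith)]; ring
      · rw [e, sub_self, abs_zero, Real.zero_rpow (by linarith)]; ring
      · rw [e, sub_self, abs_zero, Real.zero_rpow (by linarith)]; ring
    · intro s1 s2 s3 t1 t2 t3
      rw [← hd]
      simp only [del2of32]; ring
  · rintro h κ1 ρ1 κ2 ρ2 M - ⟨g0, hg0, hd⟩ hκ1 hρ1 rfl hκ2 hρ2 rfl hh
    exact part3 hγ1 hγ2 hg0 hd hκ1 hρ1 hκ2 hρ2 hh
end
end

section
/- (Two-dimensional sewing with Riemann sums.) Let γ_1, γ_2 > 1 and let g ∈ P_{2,2} be such that δ_1 g ∈ P_{3,2}^{γ_1,α} for some α > 0, δ_2 g ∈ P_{2,3}^{β,γ_2} for some β > 0, and δ g ∈ P_{3,3}^{γ_1,γ_2}. Then there exists a continuous function f : [0,1]^2 → ℝ such that for every rectangle [s_1,s_2] × [t_1,t_2] ⊆ [0,1]^2 and every sequence of grid partitions of this rectangle whose mesh tends to 0, the two-dimensional Riemann sums Σ_{i,j} g_{σ_i σ_{i+1};τ_j τ_{j+1}} converge to the rectangular increment δf_{s_1 s_2;t_1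 t_2} = f_{s_2;t_2} - f_{s_1;t_2} - f_{s_2;t_1} + f_{s_1;t_1}. -/
open Set Filter
open scoped Topology

noncomputable section

/-- The operator `δ₁ : P_{2,2} → P_{3,2}`. -/
def del1of22 (g : ℝ → ℝ → ℝ → ℝ → ℝ) (s1 s2 s3 t1 t2 : ℝ) : ℝ :=
  g s1 s3 t1 t2 - g s1 s2 t1 t2 - g s2 s3 t1 t2

/-- Rectangular increment of a two-parameter function. -/
def dRect (f : ℝ → ℝ → ℝ) (s1 s2 t1 t2 : ℝ) : ℝ :=
  f s2 t2 - f s1 t2 - f s2 t1 + f s1 t1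

/-- A sequence of partitions of `[a,b]` whose mesh tends to `0`. -/
def IsPartSeq (a b : ℝ) (m : ℕ → ℕ) (σ : ℕ → ℕ → ℝ) : Prop :=
  (∀ n, σ n 0 = a) ∧ (∀ n, σ n (m n) = b) ∧
  (∀ n, ∀ i < m n, σ n i < σ n (i + 1)) ∧
  ∀ ε : ℝ, 0 < ε → ∃ N : ℕ, ∀ n ≥ N, ∀ i < m n, σ n (i + 1) - σ n i < ε

/-- Sewing constant. -/
def Kc (γ : ℝ) : ℝ := 2 / (1 - (2:ℝ) ^ (1 - γ))

lemma Kc_aux (γ : ℝ) (hγ : 1 < γ) : (2:ℝ) ^ (1 - γ) < 1 :=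
  Real.rpow_lt_one_of_one_lt_of_neg (by norm_num) (by linarith)

lemma Kc_nonneg (γ : ℝ) (hγ : 1 < γ) : 0 ≤ Kc γ := by
  have := Kc_aux γ hγ
  unfold Kc
  apply div_nonneg <;> linarith

lemma Kc_eq (γ : ℝ) (hγ : 1 < γ) : Kc γ * (2:ℝ) ^ (1 - γ) + 2 = Kc γ := by
  have := Kc_aux γ hγ
  unfold Kc
  have h : (1 - (2:ℝ) ^ (1 - γ)) ≠ 0 := by linarith
  field_simp
  ring

lemma half_rpow_s5 (γ T : ℝ) (hT : 0 ≤ T) :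
    2 * (T / 2) ^ γ = (2:ℝ) ^ (1 - γ) * T ^ γ := by
  rw [Real.div_rpow hT (by norm_num), Real.rpow_sub (by norm_num), Real.rpow_one]
  ring

lemma youngA (h : ℝ → ℝ → ℝ) (M γ : ℝ) (hγ : 1 < γ) (hM : 0 ≤ M)
    (h0 : ∀ u ∈ I01, h u u = 0)
    (hδ : ∀ s ∈ I01, ∀ u ∈ I01, ∀ t ∈ I01, s ≤ u → u ≤ t →
      |h s t - h s u - h u t| ≤ M * (t - s) ^ γ)
    (x : ℕ → ℝ) (hx : Monotone x) (hI : ∀ k, x k ∈ I01) :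
    ∀ n a, |(∑ k ∈ Finset.Ico a (a + n), h (x k) (x (k + 1))) - h (x a) (x (a + n))| ≤
      Kc γ * M * (x (a + n) - x a) ^ γ := by
  intro n
  induction n using Nat.strong_induction_on with
  | _ n ih =>
  intro a
  have hK := Kc_nonneg γ hγ
  rcases Nat.eq_zero_or_pos n with hn | hn
  · subst hn
    simp only [add_zero, Finset.Ico_self, Finset.sum_empty, h0 _ (hI a), sub_self, abs_zero]
    positivity
  set T := x (a + n) - x a with hT
  have hT0 : 0 ≤ T := sub_nonneg.2 (hx (by omega))
  obtain ⟨j, hjn, hj1, hj2⟩ : ∃ j < n, x (a + j) - x a ≤ T / 2 ∧ x (a + n) - x (a + j + 1) ≤ T / 2 := by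
    classical
    have hex : ∃ j, x (a + n) - x (a + j + 1) ≤ T / 2 := by
      refine ⟨n - 1, ?_⟩
      have : a + (n - 1) + 1 = a + n := by omega
      rw [this]; linarith
    refine ⟨Nat.find hex, ?_, ?_, Nat.find_spec hex⟩
    · have : Nat.find hex ≤ n - 1 := by
        apply Nat.find_min'
        have : a + (n - 1) + 1 = a + n := by omega
        rw [this]; linarith
      omega
    · rcases Nat.eq_zero_or_pos (Nat.find hex) with h1 | h1
      · rw [h1]; simp only [add_zero, sub_self]; linarith
      · have h2 := Nat.find_min hex (m := Nat.find hex - 1) (by omega)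
        have : a + (Nat.find hex - 1) + 1 = a + Nat.find hex := by omega
        rw [this] at h2
        push Not at h2
        linarith
  have hsum : (∑ k ∈ Finset.Ico a (a + n), h (x k) (x (k + 1))) =
      (∑ k ∈ Finset.Ico a (a + j), h (x k) (x (k + 1))) + h (x (a + j)) (x (a + j + 1)) +
      (∑ k ∈ Finset.Ico (a + j + 1) (a + n), h (x k) (x (k + 1))) := by
    rw [← Finset.sum_Ico_consecutive _ (show a ≤ a + j + 1 by omega) (show a + j + 1 ≤ a + n by omega),
      Finset.sum_Ico_succ_top (by omega)]
  have i1 := ih j hjn a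
  have i2 := ih (n - (j + 1)) (by omega) (a + j + 1)
  rw [show a + j + 1 + (n - (j + 1)) = a + n by omega] at i2
  have d1 := hδ _ (hI a) _ (hI (a + j)) _ (hI (a + n)) (hx (by omega)) (hx (by omega))
  have d2 := hδ _ (hI (a + j)) _ (hI (a + j + 1)) _ (hI (a + n)) (hx (by omega)) (hx (by omega))
  have hxa : x a ≤ x (a + j) := hx (by omega)
  have hxb : x (a + j + 1) ≤ x (a + n) := hx (by omega)
  have hxc : x (a + j) ≤ x (a + n) := hx (by omega)
  have p1 : (x (a + j) - x a) ^ γ ≤ (T / 2) ^ γ :=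
    Real.rpow_le_rpow (by linarith) hj1 (by linarith)
  have p2 : (x (a + n) - x (a + j + 1)) ^ γ ≤ (T / 2) ^ γ :=
    Real.rpow_le_rpow (by linarith) hj2 (by linarith)
  have p3 : (x (a + n) - x (a + j)) ^ γ ≤ T ^ γ :=
    Real.rpow_le_rpow (by linarith) (by linarith) (by linarith)
  have q1 := mul_le_mul_of_nonneg_left p1 (mul_nonneg hK hM)
  have q2 := mul_le_mul_of_nonneg_left p2 (mul_nonneg hK hM)
  have q3 := mul_le_mul_of_nonneg_left p3 hM
  have e1 : Kc γ * M * (T / 2) ^ γ + Kc γ * M * (T / 2) ^ γ + 2 * (M * T ^ γ)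
      = Kc γ * M * T ^ γ := by
    have := half_rpow_s5 γ T hT0
    have h2 := Kc_eq γ hγ
    calc _ = Kc γ * M * (2 * (T / 2) ^ γ) + 2 * (M * T ^ γ) := by ring
      _ = (Kc γ * (2:ℝ) ^ (1 - γ) + 2) * M * T ^ γ := by rw [this]; ring
      _ = _ := by rw [h2]
  rw [hsum]
  rw [abs_le] at *
  constructor <;> linarith [i1.1, i1.2, i2.1, i2.2, d1.1, d1.2, d2.1, d2.2]

lemma sum_tele (φ : ℕ → ℝ) (e : ℕ → ℕ) (he : Monotone e) (m : ℕ) :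
    ∑ k ∈ Finset.Ico (e 0) (e m), φ k =
      ∑ i ∈ Finset.range m, ∑ k ∈ Finset.Ico (e i) (e (i + 1)), φ k := by
  induction m with
  | zero => simp
  | succ m ih =>
    rw [Finset.sum_range_succ, ← ih, Finset.sum_Ico_consecutive _ (he (by omega)) (he (by omega))]

lemma youngB (h : ℝ → ℝ → ℝ) (M γ : ℝ) (hγ : 1 < γ) (hM : 0 ≤ M)
    (h0 : ∀ u ∈ I01, h u u = 0)
    (hδ : ∀ s ∈ I01, ∀ u ∈ I01, ∀ t ∈ I01, s ≤ u → u ≤ t →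
      |h s t - h s u - h u t| ≤ M * (t - s) ^ γ)
    (x : ℕ → ℝ) (hx : Monotone x) (hI : ∀ k, x k ∈ I01)
    (e : ℕ → ℕ) (he : Monotone e) (m : ℕ) (ε : ℝ) (hε : 0 ≤ ε)
    (hst : ∀ i < m, x (e (i + 1)) - x (e i) ≤ ε) :
    |(∑ k ∈ Finset.Ico (e 0) (e m), h (x k) (x (k + 1))) -
      ∑ i ∈ Finset.range m, h (x (e i)) (x (e (i + 1)))| ≤ Kc γ * M * ε ^ (γ - 1) := by
  have hK := Kc_nonneg γ hγ
  rw [sum_tele _ e he, ← Finset.sum_sub_distrib]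
  have key : ∀ i ∈ Finset.range m, |(∑ k ∈ Finset.Ico (e i) (e (i + 1)), h (x k) (x (k + 1))) -
      h (x (e i)) (x (e (i + 1)))| ≤ Kc γ * M * ε ^ (γ - 1) * (x (e (i + 1)) - x (e i)) := by
    intro i hi
    have hi := Finset.mem_range.1 hi
    have h1 := youngA h M γ hγ hM h0 hδ x hx hI (e (i + 1) - e i) (e i)
    have h2 : e i + (e (i + 1) - e i) = e (i + 1) := by
      have := he (Nat.le_succ i); simp only [Nat.succ_eq_add_one] at this; omega
    rw [h2] at h1
    refine h1.trans ?_
    have hd : 0 ≤ x (e (i + 1)) - x (e i) := sub_nonneg.2 (hx (he (Nat.le_succ i)))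
    have h3 : (x (e (i + 1)) - x (e i)) ^ γ ≤ ε ^ (γ - 1) * (x (e (i + 1)) - x (e i)) := by
      have : (x (e (i + 1)) - x (e i)) ^ γ =
          (x (e (i + 1)) - x (e i)) ^ (γ - 1) * (x (e (i + 1)) - x (e i)) := by
        conv_lhs => rw [show γ = (γ - 1) + 1 by ring]
        rw [Real.rpow_add_one' hd (by linarith)]
      rw [this]
      exact mul_le_mul_of_nonneg_right (Real.rpow_le_rpow hd (hst i hi) (by linarith)) hd
    have := mul_le_mul_of_nonneg_left h3 (mul_nonneg hK hM)
    linarith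
  refine (Finset.abs_sum_le_sum_abs _ _).trans ((Finset.sum_le_sum key).trans ?_)
  rw [← Finset.mul_sum, Finset.sum_range_sub (fun i => x (e i))]
  have a1 := (hI (e m)).2
  have a2 := (hI (e 0)).1
  have : 0 ≤ Kc γ * M * ε ^ (γ - 1) := by positivity
  exact mul_le_of_le_one_right this (by linarith)

/-- One-directional hypotheses, cleaned. -/
lemma dH (g : ℝ → ℝ → ℝ → ℝ → ℝ) (M γ1 γ2 : ℝ) (hγ1 : 1 < γ1) (hγ2 : 1 < γ2) (hM : 0 ≤ M)
    (h0 : ∀ u ∈ I01, ∀ t ∈ I01, ∀ t' ∈ I01, g u u t t' = 0)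
    (hD2 : ∀ s1 ∈ I01, ∀ s2 ∈ I01, ∀ t1 ∈ I01, ∀ t2 ∈ I01, ∀ t3 ∈ I01, t1 ≤ t2 → t2 ≤ t3 →
      |del2of22 g s1 s2 t1 t2 t3| ≤ M * (t3 - t1) ^ γ2)
    (hDF : ∀ s1 ∈ I01, ∀ s2 ∈ I01, ∀ s3 ∈ I01, ∀ t1 ∈ I01, ∀ t2 ∈ I01, ∀ t3 ∈ I01,
      s1 ≤ s2 → s2 ≤ s3 → t1 ≤ t2 → t2 ≤ t3 →
      |delFull g s1 s2 s3 t1 t2 t3| ≤ M * (s3 - s1) ^ γ1 * (t3 - t1) ^ γ2)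
    (x : ℕ → ℝ) (hx : Monotone x) (hI : ∀ k, x k ∈ I01) (a b : ℕ) (hab : a ≤ b)
    (t1 : ℝ) (ht1 : t1 ∈ I01) (t2 : ℝ) (ht2 : t2 ∈ I01) (t3 : ℝ) (ht3 : t3 ∈ I01)
    (h12 : t1 ≤ t2) (h23 : t2 ≤ t3) :
    |(∑ k ∈ Finset.Ico a b, g (x k) (x (k + 1)) t1 t3) -
      (∑ k ∈ Finset.Ico a b, g (x k) (x (k + 1)) t1 t2) -
      (∑ k ∈ Finset.Ico a b, g (x k) (x (k + 1)) t2 t3)| ≤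
      (M + Kc γ1 * M) * (t3 - t1) ^ γ2 := by
  have hK := Kc_nonneg γ1 hγ1
  have hT : 0 ≤ (t3 - t1) ^ γ2 := Real.rpow_nonneg (by linarith) _
  have h1 := youngA (fun s s' => del2of22 g s s' t1 t2 t3) (M * (t3 - t1) ^ γ2) γ1 hγ1
    (by positivity)
    (by
      intro u hu
      simp only [del2of22]
      rw [h0 u hu _ ht1 _ ht3, h0 u hu _ ht1 _ ht2, h0 u hu _ ht2 _ ht3]; simp)
    (by
      intro s hs u hu t ht hsu hut
      have := hDF s hs u hu t ht t1 ht1 t2 ht2 t3 ht3 hsu hut h12 h23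
      unfold delFull at this
      refine this.trans (le_of_eq (by ring)))
    x hx hI (b - a) a
  rw [show a + (b - a) = b by omega] at h1
  have h2 := hD2 _ (hI a) _ (hI b) t1 ht1 t2 ht2 t3 ht3 h12 h23
  have h3 : (x b - x a) ^ γ1 ≤ 1 := by
    apply Real.rpow_le_one
    · exact sub_nonneg.2 (hx hab)
    · have a1 := (hI b).2
      have a2 := (hI a).1
      linarith
    · linarith
  have h4 := mul_le_of_le_one_right
    (show 0 ≤ Kc γ1 * (M * (t3 - t1) ^ γ2) by positivity) h3
  have h5 : (∑ k ∈ Finset.Ico a b, g (x k) (x (k + 1)) t1 t3) -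
      (∑ k ∈ Finset.Ico a b, g (x k) (x (k + 1)) t1 t2) -
      (∑ k ∈ Finset.Ico a b, g (x k) (x (k + 1)) t2 t3) =
      ∑ k ∈ Finset.Ico a b, del2of22 g (x k) (x (k + 1)) t1 t2 t3 := by
    simp only [del2of22, Finset.sum_sub_distrib]
  rw [h5]
  rw [abs_le] at *
  constructor <;> linarith [h1.1, h1.2, h2.1, h2.2]

/-- Refining the second direction. -/
lemma refine2 (g : ℝ → ℝ → ℝ → ℝ → ℝ) (M γ1 γ2 : ℝ) (hγ1 : 1 < γ1) (hγ2 : 1 < γ2) (hM : 0 ≤ M)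
    (h0 : ∀ u ∈ I01, ∀ t ∈ I01, ∀ t' ∈ I01, g u u t t' = 0)
    (h0' : ∀ s ∈ I01, ∀ s' ∈ I01, ∀ u ∈ I01, g s s' u u = 0)
    (hD2 : ∀ s1 ∈ I01, ∀ s2 ∈ I01, ∀ t1 ∈ I01, ∀ t2 ∈ I01, ∀ t3 ∈ I01, t1 ≤ t2 → t2 ≤ t3 →
      |del2of22 g s1 s2 t1 t2 t3| ≤ M * (t3 - t1) ^ γ2)
    (hDF : ∀ s1 ∈ I01, ∀ s2 ∈ I01, ∀ s3 ∈ I01, ∀ t1 ∈ I01, ∀ t2 ∈ I01, ∀ t3 ∈ I01,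
      s1 ≤ s2 → s2 ≤ s3 → t1 ≤ t2 → t2 ≤ t3 →
      |delFull g s1 s2 s3 t1 t2 t3| ≤ M * (s3 - s1) ^ γ1 * (t3 - t1) ^ γ2)
    (y : ℕ → ℝ) (hy : Monotone y) (hyI : ∀ k, y k ∈ I01) (a b : ℕ) (hab : a ≤ b)
    (x : ℕ → ℝ) (hx : Monotone x) (hI : ∀ k, x k ∈ I01)
    (e : ℕ → ℕ) (he : Monotone e) (m : ℕ) (ε : ℝ) (hε : 0 ≤ ε)
    (hst : ∀ i < m, x (e (i + 1)) - x (e i) ≤ ε) :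
    |(∑ k ∈ Finset.Ico (e 0) (e m), ∑ l ∈ Finset.Ico a b, g (y l) (y (l + 1)) (x k) (x (k + 1))) -
      ∑ i ∈ Finset.range m, ∑ l ∈ Finset.Ico a b, g (y l) (y (l + 1)) (x (e i)) (x (e (i + 1)))|
      ≤ Kc γ2 * (M + Kc γ1 * M) * ε ^ (γ2 - 1) := by
  have hK := Kc_nonneg γ1 hγ1
  exact youngB (fun t t' => ∑ l ∈ Finset.Ico a b, g (y l) (y (l + 1)) t t') (M + Kc γ1 * M) γ2 hγ2
    (by positivity)
    (fun u hu => Finset.sum_eq_zero fun l _ => h0' _ (hyI l) _ (hyI (l + 1)) u hu)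
    (fun t1 ht1 t2 ht2 t3 ht3 h12 h23 => dH g M γ1 γ2 hγ1 hγ2 hM h0 hD2 hDF y hy hyI a b hab
      t1 ht1 t2 ht2 t3 ht3 h12 h23)
    x hx hI e he m ε hε hst

/-- Refinement in both directions. -/
lemma refine12 (g : ℝ → ℝ → ℝ → ℝ → ℝ) (M γ1 γ2 : ℝ) (hγ1 : 1 < γ1) (hγ2 : 1 < γ2) (hM : 0 ≤ M)
    (h0 : ∀ u ∈ I01, ∀ t ∈ I01, ∀ t' ∈ I01, g u u t t' = 0)
    (h0' : ∀ s ∈ I01, ∀ s' ∈ I01, ∀ u ∈ I01, g s s' u u = 0)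
    (hD1 : ∀ s1 ∈ I01, ∀ s2 ∈ I01, ∀ s3 ∈ I01, ∀ t1 ∈ I01, ∀ t2 ∈ I01, s1 ≤ s2 → s2 ≤ s3 →
      |del1of22 g s1 s2 s3 t1 t2| ≤ M * (s3 - s1) ^ γ1)
    (hD2 : ∀ s1 ∈ I01, ∀ s2 ∈ I01, ∀ t1 ∈ I01, ∀ t2 ∈ I01, ∀ t3 ∈ I01, t1 ≤ t2 → t2 ≤ t3 →
      |del2of22 g s1 s2 t1 t2 t3| ≤ M * (t3 - t1) ^ γ2)
    (hDF : ∀ s1 ∈ I01, ∀ s2 ∈ I01, ∀ s3 ∈ I01, ∀ t1 ∈ I01, ∀ t2 ∈ I01, ∀ t3 ∈ I01,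
      s1 ≤ s2 → s2 ≤ s3 → t1 ≤ t2 → t2 ≤ t3 →
      |delFull g s1 s2 s3 t1 t2 t3| ≤ M * (s3 - s1) ^ γ1 * (t3 - t1) ^ γ2)
    (x : ℕ → ℝ) (hx : Monotone x) (hI : ∀ k, x k ∈ I01)
    (e e' : ℕ → ℕ) (he : Monotone e) (he' : Monotone e') (m m' : ℕ)
    (ε ε' : ℝ) (hε : 0 ≤ ε) (hε' : 0 ≤ ε')
    (hst : ∀ i < m, x (e (i + 1)) - x (e i) ≤ ε)
    (hst' : ∀ i < m', x (e' (i + 1)) - x (e' i) ≤ ε') :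
    |(∑ k ∈ Finset.Ico (e 0) (e m), ∑ l ∈ Finset.Ico (e' 0) (e' m'),
        g (x k) (x (k + 1)) (x l) (x (l + 1))) -
      ∑ i ∈ Finset.range m, ∑ j ∈ Finset.range m',
        g (x (e i)) (x (e (i + 1))) (x (e' j)) (x (e' (j + 1)))|
      ≤ Kc γ1 * (M + Kc γ2 * M) * ε ^ (γ1 - 1) + Kc γ2 * (M + Kc γ1 * M) * ε' ^ (γ2 - 1) := by
  have r1 := refine2 g M γ1 γ2 hγ1 hγ2 hM h0 h0' hD2 hDF (fun i => x (e i)) (hx.comp he)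
    (fun k => hI _) 0 m (Nat.zero_le _) x hx hI e' he' m' ε' hε' hst'
  have r2 := refine2 (fun t t' s s' => g s s' t t') M γ2 γ1 hγ2 hγ1 hM
    (fun u hu t ht t' ht' => h0' t ht t' ht' u hu)
    (fun s hs s' hs' u hu => h0 u hu s hs s' hs')
    (fun t1 ht1 t2 ht2 s1 hs1 s2 hs2 s3 hs3 h h' => hD1 s1 hs1 s2 hs2 s3 hs3 t1 ht1 t2 ht2 h h')
    (fun t1 ht1 t2 ht2 t3 ht3 s1 hs1 s2 hs2 s3 hs3 h h' k k' => by
      have := hDF s1 hs1 s2 hs2 s3 hs3 t1 ht1 t2 ht2 t3 ht3 k k' h h'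
      refine (le_of_eq ?_).trans (this.trans (le_of_eq (by ring)))
      congr 1
      simp only [delFull, del2of22]
      ring)
    x hx hI (e' 0) (e' m') (he' (Nat.zero_le _)) x hx hI e he m ε hε hst
  simp only [← Finset.range_eq_Ico] at r1
  rw [Finset.sum_comm, Finset.sum_comm (s := Finset.range m')] at r1
  rw [abs_le] at *
  constructor <;> linarith [r1.1, r1.2, r2.1, r2.2]

lemma exists_enum (P : Finset ℝ) : ∃ (x : ℕ → ℝ) (idx : ℝ → ℕ), Monotone x ∧ (∀ k, x k ∈ I01) ∧
    (∀ p ∈ P, p ∈ I01 → x (idx p) = p) ∧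
    (∀ p ∈ P, ∀ q ∈ P, p ∈ I01 → q ∈ I01 → p ≤ q → idx p ≤ idx q) := by
  classical
  set Q : Finset ℝ := insert 0 (P.filter (· ∈ I01)) with hQ
  have hQI : ∀ q ∈ Q, q ∈ I01 := by
    intro q hq
    rw [hQ, Finset.mem_insert, Finset.mem_filter] at hq
    rcases hq with rfl | hq
    · simp [I01]
    · exact hq.2
  have hPQ : ∀ p ∈ P, p ∈ I01 → p ∈ Q := by
    intro p hp hpI
    simp [hQ, hp, hpI]
  have hc : 0 < Q.card := Finset.card_pos.2 ⟨0, by simp [hQ]⟩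
  let o := Q.orderIsoOfFin rfl
  refine ⟨fun k => (o ⟨min k (Q.card - 1), by omega⟩ : ℝ),
    fun p => if h : p ∈ Q then (o.symm ⟨p, h⟩ : ℕ) else 0, ?_, ?_, ?_, ?_⟩
  · intro a b hab
    have : (⟨min a (Q.card - 1), by omega⟩ : Fin Q.card) ≤ ⟨min b (Q.card - 1), by omega⟩ := by
      rw [Fin.mk_le_mk]; omega
    exact o.monotone this
  · intro k
    exact hQI _ (o _).2
  · intro p hp hpI
    have hp' := hPQ p hp hpI
    simp only [hp', dif_pos]
    have : (⟨min (o.symm ⟨p, hp'⟩ : ℕ) (Q.card - 1), by omega⟩ : Fin Q.card) = o.symm ⟨p, hp'⟩ := by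
      ext
      have := (o.symm ⟨p, hp'⟩).2
      simp only
      omega
    rw [this]
    simp
  · intro p hp q hq hpI hqI hpq
    simp only [hPQ p hp hpI, hPQ q hq hqI, dif_pos]
    exact o.symm.monotone (show (⟨p, _⟩ : Q) ≤ ⟨q, _⟩ from hpq)

lemma ico_split (φ : ℕ → ℝ) (a b c : ℕ) (hab : a ≤ b) (hbc : b ≤ c) :
    ∑ k ∈ Finset.Ico b c, φ k = ∑ k ∈ Finset.Ico a c, φ k - ∑ k ∈ Finset.Ico a b, φ k := by
  rw [← Finset.sum_Ico_consecutive _ hab hbc]; ring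

lemma core (g : ℝ → ℝ → ℝ → ℝ → ℝ) (M γ1 γ2 : ℝ) (hγ1 : 1 < γ1) (hγ2 : 1 < γ2) (hM : 0 ≤ M)
    (h0 : ∀ u ∈ I01, ∀ t ∈ I01, ∀ t' ∈ I01, g u u t t' = 0)
    (h0' : ∀ s ∈ I01, ∀ s' ∈ I01, ∀ u ∈ I01, g s s' u u = 0)
    (hD1 : ∀ s1 ∈ I01, ∀ s2 ∈ I01, ∀ s3 ∈ I01, ∀ t1 ∈ I01, ∀ t2 ∈ I01, s1 ≤ s2 → s2 ≤ s3 →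
      |del1of22 g s1 s2 s3 t1 t2| ≤ M * (s3 - s1) ^ γ1)
    (hD2 : ∀ s1 ∈ I01, ∀ s2 ∈ I01, ∀ t1 ∈ I01, ∀ t2 ∈ I01, ∀ t3 ∈ I01, t1 ≤ t2 → t2 ≤ t3 →
      |del2of22 g s1 s2 t1 t2 t3| ≤ M * (t3 - t1) ^ γ2)
    (hDF : ∀ s1 ∈ I01, ∀ s2 ∈ I01, ∀ s3 ∈ I01, ∀ t1 ∈ I01, ∀ t2 ∈ I01, ∀ t3 ∈ I01,
      s1 ≤ s2 → s2 ≤ s3 → t1 ≤ t2 → t2 ≤ t3 →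
      |delFull g s1 s2 s3 t1 t2 t3| ≤ M * (s3 - s1) ^ γ1 * (t3 - t1) ^ γ2) :
    ∃ (f : ℝ → ℝ → ℝ) (A B : ℝ), ∀ (y y' : ℕ → ℝ), Monotone y → Monotone y' →
      (∀ i, y i ∈ I01) → (∀ i, y' i ∈ I01) → ∀ (m m' : ℕ) (ε ε' : ℝ), 0 ≤ ε → 0 ≤ ε' →
      (∀ i < m, y (i + 1) - y i ≤ ε) → (∀ i < m', y' (i + 1) - y' i ≤ ε') →
      |dRect f (y 0) (y m) (y' 0) (y' m') - ∑ i ∈ Finset.range m, ∑ j ∈ Finset.range m',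
        g (y i) (y (i + 1)) (y' j) (y' (j + 1))| ≤ A * ε ^ (γ1 - 1) + B * ε' ^ (γ2 - 1) := by
  classical
  choose x idx hxm hxI hxidx hidx using exists_enum
  set A := Kc γ1 * (M + Kc γ2 * M) with hA
  set B := Kc γ2 * (M + Kc γ1 * M) with hB
  -- sums over the grid given by `P`
  let S : Finset ℝ → ℝ → ℝ → ℝ → ℝ → ℝ := fun P s1 s2 t1 t2 =>
    ∑ k ∈ Finset.Ico (idx P s1) (idx P s2), ∑ l ∈ Finset.Ico (idx P t1) (idx P t2),
        g (x P k) (x P (k + 1)) (x P l) (x P (l + 1))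
  have hz : (0:ℝ) ∈ I01 := by simp [I01]
  have est : ∀ (y y' : ℕ → ℝ), Monotone y → Monotone y' →
      (∀ i, y i ∈ I01) → (∀ i, y' i ∈ I01) → ∀ (m m' : ℕ) (ε ε' : ℝ), 0 ≤ ε → 0 ≤ ε' →
      (∀ i < m, y (i + 1) - y i ≤ ε) → (∀ i < m', y' (i + 1) - y' i ≤ ε') →
      ∀ᶠ P : Finset ℝ in atTop, |S P (y 0) (y m) (y' 0) (y' m') -
        ∑ i ∈ Finset.range m, ∑ j ∈ Finset.range m',
        g (y i) (y (i + 1)) (y' j) (y' (j + 1))| ≤ A * ε ^ (γ1 - 1) + B * ε' ^ (γ2 - 1) := by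
    intro y y' hy hy' hyI hyI' m m' ε ε' hε hε' hst hst'
    filter_upwards [eventually_ge_atTop ((Finset.range (m + 1)).image y ∪
      (Finset.range (m' + 1)).image y')] with P hP
    have hmem : ∀ i, y (min i m) ∈ P := fun i => hP (by
      apply Finset.mem_union_left
      exact Finset.mem_image_of_mem _ (by simp))
    have hmem' : ∀ i, y' (min i m') ∈ P := fun i => hP (by
      apply Finset.mem_union_right
      exact Finset.mem_image_of_mem _ (by simp))
    have key := refine12 g M γ1 γ2 hγ1 hγ2 hM h0 h0' hD1 hD2 hDF (x P) (hxm P) (hxI P)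
      (fun i => idx P (y (min i m))) (fun i => idx P (y' (min i m')))
      (fun i j hij => hidx P _ (hmem i) _ (hmem j) (hyI _) (hyI _) (hy (by omega)))
      (fun i j hij => hidx P _ (hmem' i) _ (hmem' j) (hyI' _) (hyI' _) (hy' (by omega)))
      m m' ε ε' hε hε'
      (by
        intro i hi
        simp only [hxidx P _ (hmem _) (hyI _)]
        rw [min_eq_left (by omega : i + 1 ≤ m), min_eq_left (by omega : i ≤ m)]
        exact hst i hi)
      (by
        intro i hi
        simp only [hxidx P _ (hmem' _) (hyI' _)]
        rw [min_eq_left (by omega : i + 1 ≤ m'), min_eq_left (by omega : i ≤ m')]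
        exact hst' i hi)
    simp only [hxidx P _ (hmem' _) (hyI' _), hxidx P _ (hmem _) (hyI _), min_self,
      Nat.zero_min] at key
    have hs : (∑ i ∈ Finset.range m, ∑ j ∈ Finset.range m',
        g (y i) (y (i + 1)) (y' j) (y' (j + 1))) = ∑ i ∈ Finset.range m, ∑ j ∈ Finset.range m',
        g (y (min i m)) (y (min (i + 1) m)) (y' (min j m')) (y' (min (j + 1) m')) := by
      refine Finset.sum_congr rfl fun i hi => Finset.sum_congr rfl fun j hj => ?_
      have hi := Finset.mem_range.1 hi
      have hj := Finset.mem_range.1 hj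
      rw [min_eq_left (by omega : i + 1 ≤ m), min_eq_left (by omega : i ≤ m),
        min_eq_left (by omega : j + 1 ≤ m'), min_eq_left (by omega : j ≤ m')]
    rw [hs]
    exact key
  let U : Ultrafilter (Finset ℝ) := Ultrafilter.of atTop
  have hU : (U : Filter (Finset ℝ)) ≤ atTop := Ultrafilter.of_le _
  have hlim : ∀ s t : ℝ, ∃ l, s ∈ I01 → t ∈ I01 →
      Tendsto (fun P => S P 0 s 0 t) U (𝓝 l) := by
    intro s t
    by_cases hst : s ∈ I01 ∧ t ∈ I01
    · obtain ⟨hs, ht⟩ := hst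
      have hmono : ∀ r ∈ I01, Monotone (fun i : ℕ => if i = 0 then (0:ℝ) else r) := by
        intro r hr i j hij
        have := hr.1
        dsimp only
        split_ifs <;> first | omega | linarith
      have hin : ∀ r ∈ I01, ∀ i : ℕ, (if i = 0 then (0:ℝ) else r) ∈ I01 := by
        intro r hr i
        split_ifs
        · exact hz
        · exact hr
      have h1 := est (fun i => if i = 0 then (0:ℝ) else s) (fun i => if i = 0 then (0:ℝ) else t)
        (hmono s hs) (hmono t ht) (hin s hs) (hin t ht) 1 1 1 1 zero_le_one zero_le_one
        (by intro i hi; have : i = 0 := by omega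
            subst this; simpa using hs.2)
        (by intro i hi; have : i = 0 := by omega
            subst this; simpa using ht.2)
      simp only [Finset.range_one, Finset.sum_singleton, if_true, one_ne_zero, if_false,
        zero_add, Real.one_rpow, mul_one] at h1
      have hc : IsCompact (Set.Icc (g 0 s 0 t - (A + B)) (g 0 s 0 t + (A + B))) := isCompact_Icc
      obtain ⟨l, -, hl⟩ := hc.ultrafilter_le_nhds (U.map (fun P => S P 0 s 0 t)) (by
        rw [le_principal_iff]
        show ∀ᶠ P in (U : Filter (Finset ℝ)), S P 0 s 0 t ∈ _
        filter_upwards [hU h1] with P hP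
        rw [abs_le] at hP
        constructor <;> linarith [hP.1, hP.2])
      exact ⟨l, fun _ _ => hl⟩
    · exact ⟨0, fun h h' => absurd ⟨h, h'⟩ hst⟩
  choose f hf using hlim
  refine ⟨f, A, B, ?_⟩
  intro y y' hy hy' hyI hyI' m m' ε ε' hε hε' hst hst'
  have e1 := hU (est y y' hy hy' hyI hyI' m m' ε ε' hε hε' hst hst')
  have hT : Tendsto (fun P => S P (y 0) (y m) (y' 0) (y' m')) U
      (𝓝 (dRect f (y 0) (y m) (y' 0) (y' m'))) := by
    have hT1 := (((hf _ _ (hyI m) (hyI' m')).sub (hf _ _ (hyI 0) (hyI' m'))).sub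
      (hf _ _ (hyI m) (hyI' 0))).add (hf _ _ (hyI 0) (hyI' 0))
    refine hT1.congr' ?_
    apply hU
    filter_upwards [eventually_ge_atTop ({0, y 0, y m, y' 0, y' m'} : Finset ℝ)] with P hP
    have m0 : (0:ℝ) ∈ P := hP (by simp)
    have m1 : y 0 ∈ P := hP (by simp)
    have m2 : y m ∈ P := hP (by simp)
    have m3 : y' 0 ∈ P := hP (by simp)
    have m4 : y' m' ∈ P := hP (by simp)
    have i1 : idx P 0 ≤ idx P (y 0) := hidx P _ m0 _ m1 hz (hyI 0) (hyI 0).1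
    have i2 : idx P (y 0) ≤ idx P (y m) := hidx P _ m1 _ m2 (hyI 0) (hyI m) (hy (Nat.zero_le _))
    have i3 : idx P 0 ≤ idx P (y' 0) := hidx P _ m0 _ m3 hz (hyI' 0) (hyI' 0).1
    have i4 : idx P (y' 0) ≤ idx P (y' m') :=
      hidx P _ m3 _ m4 (hyI' 0) (hyI' m') (hy' (Nat.zero_le _))
    simp only [S]
    rw [ico_split _ _ _ _ i1 i2]
    simp only [ico_split _ _ _ _ i3 i4, Finset.sum_sub_distrib]
    ring
  exact le_of_tendsto ((hT.sub_const _).abs) e1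

lemma rpow_bound (M a b c κ ρ γ : ℝ) (hκ : 0 < κ) (hρ : 0 < ρ) (h : κ + ρ = γ)
    (hM : 0 ≤ M) (hab : a ≤ b) (hbc : b ≤ c) :
    |b - a| ^ κ * |c - b| ^ ρ ≤ (c - a) ^ γ := by
  rw [abs_of_nonneg (by linarith), abs_of_nonneg (by linarith), ← h,
    Real.rpow_add_of_nonneg (by linarith) hκ.le hρ.le]
  exact mul_le_mul (Real.rpow_le_rpow (by linarith) (by linarith) hκ.le)
    (Real.rpow_le_rpow (by linarith) (by linarith) hρ.le)
    (Real.rpow_nonneg (by linarith) _) (Real.rpow_nonneg (by linarith) _)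

lemma abs_rpow_le_one (a b α : ℝ) (hα : 0 < α) (ha : a ∈ I01) (hb : b ∈ I01) :
    |b - a| ^ α ≤ 1 := by
  apply Real.rpow_le_one (abs_nonneg _) _ hα.le
  have h1 := ha.1
  have h2 := ha.2
  have h3 := hb.1
  have h4 := hb.2
  rw [abs_le]; constructor <;> linarith

/-- Two-dimensional sewing with Riemann sums. -/
theorem two_dimensional_sewing_riemann_sums
    (γ1 γ2 α β : ℝ) (hγ1 : 1 < γ1) (hγ2 : 1 < γ2) (hα : 0 < α) (hβ : 0 < β)
    (g : ℝ → ℝ → ℝ → ℝ → ℝ) (hg : MemP22 g)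
    (hd1 : ∃ κ1 ρ1 M : ℝ, 0 < κ1 ∧ 0 < ρ1 ∧ κ1 + ρ1 = γ1 ∧
      ∀ (s1 s2 s3 t1 t2 : I01),
        |del1of22 g (s1 : ℝ) (s2 : ℝ) (s3 : ℝ) (t1 : ℝ) (t2 : ℝ)| ≤
          M * |(s2 : ℝ) - (s1 : ℝ)| ^ κ1 * |(s3 : ℝ) - (s2 : ℝ)| ^ ρ1 *
            |(t2 : ℝ) - (t1 : ℝ)| ^ α)
    (hd2 : ∃ κ2 ρ2 M : ℝ, 0 < κ2 ∧ 0 < ρ2 ∧ κ2 + ρ2 = γ2 ∧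
      ∀ (s1 s2 t1 t2 t3 : I01),
        |del2of22 g (s1 : ℝ) (s2 : ℝ) (t1 : ℝ) (t2 : ℝ) (t3 : ℝ)| ≤
          M * |(s2 : ℝ) - (s1 : ℝ)| ^ β * |(t2 : ℝ) - (t1 : ℝ)| ^ κ2 *
            |(t3 : ℝ) - (t2 : ℝ)| ^ ρ2)
    (hdF : ∃ κ1 ρ1 κ2 ρ2 M : ℝ, 0 < κ1 ∧ 0 < ρ1 ∧ κ1 + ρ1 = γ1 ∧
      0 < κ2 ∧ 0 < ρ2 ∧ κ2 + ρ2 = γ2 ∧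
      ∀ (s1 s2 s3 t1 t2 t3 : I01),
        |delFull g (s1 : ℝ) (s2 : ℝ) (s3 : ℝ) (t1 : ℝ) (t2 : ℝ) (t3 : ℝ)| ≤
          M * |(s2 : ℝ) - (s1 : ℝ)| ^ κ1 * |(s3 : ℝ) - (s2 : ℝ)| ^ ρ1 *
            |(t2 : ℝ) - (t1 : ℝ)| ^ κ2 * |(t3 : ℝ) - (t2 : ℝ)| ^ ρ2) :
    ∃ f : ℝ → ℝ → ℝ,
      ContinuousOn (fun p : ℝ × ℝ => f p.1 p.2) (I01 ×ˢ I01) ∧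
      ∀ s1 ∈ I01, ∀ s2 ∈ I01, ∀ t1 ∈ I01, ∀ t2 ∈ I01, s1 ≤ s2 → t1 ≤ t2 →
        ∀ (m m' : ℕ → ℕ) (σ τ : ℕ → ℕ → ℝ),
          IsPartSeq s1 s2 m σ → IsPartSeq t1 t2 m' τ →
          Tendsto (fun n => ∑ i ∈ Finset.range (m n), ∑ j ∈ Finset.range (m' n),
              g (σ n i) (σ n (i + 1)) (τ n j) (τ n (j + 1)))
            atTop (𝓝 (dRect f s1 s2 t1 t2)) := by
  obtain ⟨κ1, ρ1, M1, hκ1, hρ1, hs1, hd1⟩ := hd1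
  obtain ⟨κ2, ρ2, M2, hκ2, hρ2, hs2, hd2⟩ := hd2
  obtain ⟨κ3, ρ3, κ4, ρ4, M3, hκ3, hρ3, hs3, hκ4, hρ4, hs4, hdF⟩ := hdF
  set M := max |M1| (max |M2| |M3|) with hMdef
  have hM : 0 ≤ M := (abs_nonneg M1).trans (le_max_left _ _)
  have hM1 : M1 ≤ M := (le_abs_self _).trans (le_max_left _ _)
  have hM2 : M2 ≤ M := (le_abs_self _).trans ((le_max_left _ _).trans (le_max_right _ _))
  have hM3 : M3 ≤ M := (le_abs_self _).trans ((le_max_right _ _).trans (le_max_right _ _))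
  obtain ⟨f, A, B, hf⟩ := core g M γ1 γ2 hγ1 hγ2 hM
    (fun u hu t ht t' ht' => hg.2 ⟨u, hu⟩ ⟨u, hu⟩ ⟨t, ht⟩ ⟨t', ht'⟩ (Or.inl rfl))
    (fun s hs s' hs' u hu => hg.2 ⟨s, hs⟩ ⟨s', hs'⟩ ⟨u, hu⟩ ⟨u, hu⟩ (Or.inr rfl))
    (by
      intro s1 h1 s2 h2 s3 h3 t1 k1 t2 k2 h12 h23
      have := hd1 ⟨s1, h1⟩ ⟨s2, h2⟩ ⟨s3, h3⟩ ⟨t1, k1⟩ ⟨t2, k2⟩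
      refine this.trans ?_
      have b1 := rpow_bound M s1 s2 s3 κ1 ρ1 γ1 hκ1 hρ1 hs1 hM h12 h23
      have b2 := abs_rpow_le_one t1 t2 α hα k1 k2
      have p1 : 0 ≤ |s2 - s1| ^ κ1 * |s3 - s2| ^ ρ1 := by positivity
      have p2 : 0 ≤ |t2 - t1| ^ α := by positivity
      calc M1 * |s2 - s1| ^ κ1 * |s3 - s2| ^ ρ1 * |t2 - t1| ^ α
          = M1 * ((|s2 - s1| ^ κ1 * |s3 - s2| ^ ρ1) * |t2 - t1| ^ α) := by ring
        _ ≤ M * ((|s2 - s1| ^ κ1 * |s3 - s2| ^ ρ1) * |t2 - t1| ^ α) :=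
          mul_le_mul_of_nonneg_right hM1 (mul_nonneg p1 p2)
        _ ≤ M * (s3 - s1) ^ γ1 :=
          mul_le_mul_of_nonneg_left ((mul_le_of_le_one_right p1 b2).trans b1) hM)
    (by
      intro s1 h1 s2 h2 t1 k1 t2 k2 t3 k3 h12 h23
      have := hd2 ⟨s1, h1⟩ ⟨s2, h2⟩ ⟨t1, k1⟩ ⟨t2, k2⟩ ⟨t3, k3⟩
      refine this.trans ?_
      have b1 := rpow_bound M t1 t2 t3 κ2 ρ2 γ2 hκ2 hρ2 hs2 hM h12 h23
      have b2 := abs_rpow_le_one s1 s2 β hβ h1 h2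
      have p1 : 0 ≤ |t2 - t1| ^ κ2 * |t3 - t2| ^ ρ2 := by positivity
      have p2 : 0 ≤ |s2 - s1| ^ β := by positivity
      calc M2 * |s2 - s1| ^ β * |t2 - t1| ^ κ2 * |t3 - t2| ^ ρ2
          = M2 * ((|t2 - t1| ^ κ2 * |t3 - t2| ^ ρ2) * |s2 - s1| ^ β) := by ring
        _ ≤ M * ((|t2 - t1| ^ κ2 * |t3 - t2| ^ ρ2) * |s2 - s1| ^ β) :=
          mul_le_mul_of_nonneg_right hM2 (mul_nonneg p1 p2)
        _ ≤ M * (t3 - t1) ^ γ2 :=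
          mul_le_mul_of_nonneg_left ((mul_le_of_le_one_right p1 b2).trans b1) hM)
    (by
      intro s1 h1 s2 h2 s3 h3 t1 k1 t2 k2 t3 k3 h12 h23 k12 k23
      have := hdF ⟨s1, h1⟩ ⟨s2, h2⟩ ⟨s3, h3⟩ ⟨t1, k1⟩ ⟨t2, k2⟩ ⟨t3, k3⟩
      refine this.trans ?_
      have b1 := rpow_bound M s1 s2 s3 κ3 ρ3 γ1 hκ3 hρ3 hs3 hM h12 h23
      have b2 := rpow_bound M t1 t2 t3 κ4 ρ4 γ2 hκ4 hρ4 hs4 hM k12 k23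
      have p1 : 0 ≤ |s2 - s1| ^ κ3 * |s3 - s2| ^ ρ3 := by positivity
      have p2 : 0 ≤ |t2 - t1| ^ κ4 * |t3 - t2| ^ ρ4 := by positivity
      calc M3 * |s2 - s1| ^ κ3 * |s3 - s2| ^ ρ3 * |t2 - t1| ^ κ4 * |t3 - t2| ^ ρ4
          = M3 * ((|s2 - s1| ^ κ3 * |s3 - s2| ^ ρ3) * (|t2 - t1| ^ κ4 * |t3 - t2| ^ ρ4)) := by ring
        _ ≤ M * ((|s2 - s1| ^ κ3 * |s3 - s2| ^ ρ3) * (|t2 - t1| ^ κ4 * |t3 - t2| ^ ρ4)) :=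
          mul_le_mul_of_nonneg_right hM3 (mul_nonneg p1 p2)
        _ ≤ M * ((s3 - s1) ^ γ1 * (t3 - t1) ^ γ2) :=
          mul_le_mul_of_nonneg_left (mul_le_mul b1 b2 p2 (p1.trans b1)) hM
        _ = _ := by ring)
  -- the modulus
  have hmod : Tendsto (fun ε : ℝ => A * ε ^ (γ1 - 1) + B * ε ^ (γ2 - 1)) (𝓝 0) (𝓝 0) := by
    have h1 : ContinuousAt (fun ε : ℝ => A * ε ^ (γ1 - 1) + B * ε ^ (γ2 - 1)) 0 :=
      (continuousAt_const.mul (Real.continuousAt_rpow_const _ _ (Or.inr (by linarith)))).add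
        (continuousAt_const.mul (Real.continuousAt_rpow_const _ _ (Or.inr (by linarith))))
    have h2 := h1.tendsto
    simpa [Real.zero_rpow (show γ1 - 1 ≠ 0 by linarith),
      Real.zero_rpow (show γ2 - 1 ≠ 0 by linarith)] using h2
  have hI : ∀ s ∈ I01, ∀ n i : ℕ, s * (min ((i:ℝ) / (n + 1)) 1) ∈ I01 := by
    intro s hs n i
    have h1 : 0 ≤ min ((i:ℝ) / (n + 1)) 1 := le_min (by positivity) zero_le_one
    exact ⟨mul_nonneg hs.1 h1, mul_le_one₀ hs.2 h1 (min_le_right _ _)⟩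
  refine ⟨fun s t => dRect f 0 s 0 t, ?_, ?_⟩
  · -- uniform limit of continuous functions
    let F : ℕ → ℝ × ℝ → ℝ := fun n p => ∑ i ∈ Finset.range (n + 1), ∑ j ∈ Finset.range (n + 1),
      g (p.1 * (min ((i:ℝ) / (n + 1)) 1)) (p.1 * (min (((i + 1 : ℕ):ℝ) / (n + 1)) 1))
        (p.2 * (min ((j:ℝ) / (n + 1)) 1)) (p.2 * (min (((j + 1 : ℕ):ℝ) / (n + 1)) 1))
    have hFc : ∀ n, ContinuousOn (F n) (I01 ×ˢ I01) := by
      intro n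
      refine continuousOn_finsetSum _ fun i _ => continuousOn_finsetSum _ fun j _ => ?_
      refine hg.1.comp (f := fun p : ℝ × ℝ => (p.1 * (min ((i:ℝ) / (n + 1)) 1),
        p.1 * (min (((i + 1 : ℕ):ℝ) / (n + 1)) 1),
        p.2 * (min ((j:ℝ) / (n + 1)) 1), p.2 * (min (((j + 1 : ℕ):ℝ) / (n + 1)) 1))) ?_ ?_
      · exact Continuous.continuousOn (by fun_prop)
      · intro p hp
        exact ⟨hI _ hp.1 _ _, hI _ hp.1 _ _, hI _ hp.2 _ _, hI _ hp.2 _ _⟩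
    have hu : TendstoUniformlyOn F (fun p : ℝ × ℝ => dRect f 0 p.1 0 p.2) atTop (I01 ×ˢ I01) := by
      rw [Metric.tendstoUniformlyOn_iff]
      intro η hη
      have h1 := (hmod.comp tendsto_one_div_add_atTop_nhds_zero_nat).eventually (gt_mem_nhds hη)
      filter_upwards [h1] with n hn p hp
      have hmono : ∀ s ∈ I01, Monotone (fun i : ℕ => s * (min ((i:ℝ) / (n + 1)) 1)) := by
        intro s hs i j hij
        refine mul_le_mul_of_nonneg_left (min_le_min_right _ ?_) hs.1
        gcongr
      have hstep : ∀ s ∈ I01, ∀ i < n + 1, s * (min (((i + 1 : ℕ):ℝ) / (n + 1)) 1) -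
          s * (min ((i:ℝ) / (n + 1)) 1) ≤ 1 / ((n:ℝ) + 1) := by
        intro s hs i hi
        have hi' : (i:ℝ) + 1 ≤ n + 1 := by exact_mod_cast hi
        have hn0 : (0:ℝ) < n + 1 := by positivity
        rw [min_eq_left, min_eq_left, ← mul_sub]
        · push_cast
          rw [← sub_div, add_sub_cancel_left]
          exact mul_le_of_le_one_left (by positivity) hs.2
        · rw [div_le_one hn0]; linarith
        · rw [div_le_one hn0]; push_cast; linarith
      have h2 := hf _ _ (hmono _ hp.1) (hmono _ hp.2) (hI _ hp.1 n) (hI _ hp.2 n) (n + 1) (n + 1)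
        (1 / ((n:ℝ) + 1)) (1 / ((n:ℝ) + 1)) (by positivity) (by positivity)
        (hstep _ hp.1) (hstep _ hp.2)
      have hz : min (((0:ℕ):ℝ) / (n + 1)) 1 = 0 := by simp
      have ho : min (((n + 1 : ℕ):ℝ) / (n + 1)) 1 = 1 := by
        push_cast
        rw [div_self (by positivity)]; simp
      simp only [hz, ho, mul_zero, mul_one] at h2
      rw [Real.dist_eq]
      exact lt_of_le_of_lt h2 hn
    exact hu.continuousOn (Frequently.of_forall hFc)
  · intro s1 hs1 s2 hs2 t1 ht1 t2 ht2 hs ht m m' σ τ hσ hτ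
    have hd : dRect (fun s t => dRect f 0 s 0 t) s1 s2 t1 t2 = dRect f s1 s2 t1 t2 := by
      simp only [dRect]; ring
    rw [hd]
    -- monotone extension of partitions
    have ext : ∀ (a b : ℝ), a ∈ I01 → b ∈ I01 → ∀ (m : ℕ → ℕ) (σ : ℕ → ℕ → ℝ),
        IsPartSeq a b m σ → ∀ n, Monotone (fun i => σ n (min i (m n))) ∧
          ∀ i, σ n (min i (m n)) ∈ I01 := by
      intro a b ha hb m σ hσ n
      have hmono : Monotone (fun i => σ n (min i (m n))) := by
        refine monotone_nat_of_le_succ fun i => ?_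
        rcases lt_or_ge i (m n) with h | h
        · rw [min_eq_left h.le, min_eq_left (by omega : i + 1 ≤ m n)]
          exact (hσ.2.2.1 n i h).le
        · rw [min_eq_right h, min_eq_right (by omega : m n ≤ i + 1)]
      refine ⟨hmono, fun i => ⟨?_, ?_⟩⟩
      · have := hmono (Nat.zero_le i)
        simp only [Nat.zero_min, hσ.1 n] at this
        exact ha.1.trans this
      · have := hmono (le_max_left i (m n))
        simp only [min_eq_right (le_max_right i (m n)), hσ.2.1 n] at this
        exact this.trans hb.2
    rw [Metric.tendsto_atTop]
    intro η hη
    obtain ⟨ε, hε, hlt⟩ : ∃ ε : ℝ, 0 < ε ∧ A * ε ^ (γ1 - 1) + B * ε ^ (γ2 - 1) < η := by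
      have h1 := (hmod.mono_left (nhdsWithin_le_nhds (s := Set.Ioi 0))).eventually (gt_mem_nhds hη)
      obtain ⟨ε, h, h'⟩ := (h1.and self_mem_nhdsWithin).exists
      exact ⟨ε, h', h⟩
    obtain ⟨N, hN⟩ := hσ.2.2.2 ε hε
    obtain ⟨N', hN'⟩ := hτ.2.2.2 ε hε
    refine ⟨max N N', fun n hn => ?_⟩
    obtain ⟨q1, q2⟩ := ext s1 s2 hs1 hs2 m σ hσ n
    obtain ⟨r1, r2⟩ := ext t1 t2 ht1 ht2 m' τ hτ n
    have h2 := hf _ _ q1 r1 q2 r2 (m n) (m' n) ε ε hε.le hε.le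
      (by
        intro i hi
        rw [min_eq_left (by omega : i + 1 ≤ m n), min_eq_left (by omega : i ≤ m n)]
        exact (hN n ((le_max_left _ _).trans hn) i hi).le)
      (by
        intro i hi
        rw [min_eq_left (by omega : i + 1 ≤ m' n), min_eq_left (by omega : i ≤ m' n)]
        exact (hN' n ((le_max_right _ _).trans hn) i hi).le)
    simp only [Nat.zero_min, min_self, hσ.1 n, hσ.2.1 n, hτ.1 n, hτ.2.1 n] at h2
    have hsum : (∑ i ∈ Finset.range (m n), ∑ j ∈ Finset.range (m' n),
        g (σ n i) (σ n (i + 1)) (τ n j) (τ n (j + 1))) =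
        ∑ i ∈ Finset.range (m n), ∑ j ∈ Finset.range (m' n),
        g (σ n (min i (m n))) (σ n (min (i + 1) (m n))) (τ n (min j (m' n)))
          (τ n (min (j + 1) (m' n))) := by
      refine Finset.sum_congr rfl fun i hi => Finset.sum_congr rfl fun j hj => ?_
      have hi := Finset.mem_range.1 hi
      have hj := Finset.mem_range.1 hj
      rw [min_eq_left (by omega : i + 1 ≤ m n), min_eq_left (by omega : i ≤ m n),
        min_eq_left (by omega : j + 1 ≤ m' n), min_eq_left (by omega : j ≤ m' n)]
    rw [dist_comm, Real.dist_eq, hsum]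
    exact lt_of_le_of_lt h2 hlt
end
end
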